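/- arXiv:2309.05547 — 2 statements merged into one kernel-verified Lean document; each statement's English description precedes it below -/
import Mathlib

section
/- Let γ : Q₄ → PGL(3,R) be as below and let N be the normal closure in G of the single element [yxy,x]·t·x⁻¹·t⁻¹. Then the kernel of γ equals the preimage under ε of N; that is, for every q ∈ Q₄, γ(q) = 1 if and only if ε(q) ∈ N. -/
/-!
Common setup: the commutator convention `[a,b] = a⁻¹b⁻¹ab` of the paper, the sequence
`x₀ = x`, `x_{i+1} = [yxy, x_i]`, the Laurent polynomial ring `R = 𝔽₂[t,t⁻¹]`, and the
images `X`, `Y` of `σ₁σ₂σ₃` and `σ₁σ₂σ₃σ₁` in `GL(3, R)` under the mod-2 reduced Burau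
representation of the 4-strand braid group.
-/

open Matrix LaurentPolynomial

noncomputable section

set_option maxRecDepth 100000

/-- The paper's commutator convention: `[a,b] = a⁻¹b⁻¹ab`. -/
def br {G : Type*} [Group G] (a b : G) : G := a⁻¹ * b⁻¹ * a * b

/-- The recursively defined elements `x₀ = x`, `x_{i+1} = [yxy, x_i]`. -/
def xseq {G : Type*} [Group G] (x y : G) : ℕ → G
  | 0 => x
  | n + 1 => br (y * x * y) (xseq x y n)

/-- `R = 𝔽₂[t,t⁻¹]`, the ring of Laurent polynomials over the field with two elements. -/
abbrev R2 : Type := LaurentPolynomial (ZMod 2)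

instance : CharP R2 2 := charP_of_injective_algebraMap (algebraMap (ZMod 2) R2).injective 2

/-- The matrix `X = t·!![0,0,1; 1,0,1; 0,1,1]`. -/
def Xmat : Matrix (Fin 3) (Fin 3) R2 := (T 1 : R2) • !![0,0,1; 1,0,1; 0,1,1]

/-- The matrix `Y = t·!![0,0,1; t,1,1; 0,1,1]`. -/
def Ymat : Matrix (Fin 3) (Fin 3) R2 := (T 1 : R2) • !![0,0,1; T 1,1,1; 0,1,1]

/-- An explicit inverse for `Xmat`. -/
def Xmatinv : Matrix (Fin 3) (Fin 3) R2 := (T (-1) : R2) • !![1,1,0; 1,0,1; 1,0,0]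

/-- An explicit inverse for `Ymat`. -/
def Ymatinv : Matrix (Fin 3) (Fin 3) R2 := (T (-2) : R2) • !![0,1,1; T 1,0,T 1; T 1,0,0]

lemma Xmat_mul_Xmatinv : Xmat * Xmatinv = 1 := by
  rw [Xmat, Xmatinv, Matrix.smul_mul, Matrix.mul_smul, smul_smul, ← T_add]
  simp only [Matrix.mul_fin_three, mul_zero, zero_mul, mul_one, one_mul, add_zero, zero_add,
    ← T_add, CharTwo.add_self_eq_zero]
  rw [Matrix.one_fin_three]
  simp only [Matrix.smul_of, Matrix.smul_cons, smul_eq_mul, Matrix.smul_empty, ← T_add,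
    mul_zero, mul_one]
  norm_num [T_zero]

lemma Xmatinv_mul_Xmat : Xmatinv * Xmat = 1 := by
  rw [Xmat, Xmatinv, Matrix.smul_mul, Matrix.mul_smul, smul_smul, ← T_add]
  simp only [Matrix.mul_fin_three, mul_zero, zero_mul, mul_one, one_mul, add_zero, zero_add,
    ← T_add, CharTwo.add_self_eq_zero]
  rw [Matrix.one_fin_three]
  simp only [Matrix.smul_of, Matrix.smul_cons, smul_eq_mul, Matrix.smul_empty, ← T_add,
    mul_zero, mul_one]
  norm_num [T_zero]

lemma Ymat_mul_Ymatinv : Ymat * Ymatinv = 1 := by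
  rw [Ymat, Ymatinv, Matrix.smul_mul, Matrix.mul_smul, smul_smul, ← T_add]
  simp only [Matrix.mul_fin_three, mul_zero, zero_mul, mul_one, one_mul, add_zero, zero_add,
    ← T_add, CharTwo.add_self_eq_zero]
  rw [Matrix.one_fin_three]
  simp only [Matrix.smul_of, Matrix.smul_cons, smul_eq_mul, Matrix.smul_empty, ← T_add,
    mul_zero, mul_one]
  norm_num [T_zero]

lemma Ymatinv_mul_Ymat : Ymatinv * Ymat = 1 := by
  rw [Ymat, Ymatinv, Matrix.mul_smul, Matrix.smul_mul, smul_smul, ← T_add]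
  simp only [Matrix.mul_fin_three, mul_zero, zero_mul, mul_one, one_mul, add_zero, zero_add,
    ← T_add, CharTwo.add_self_eq_zero]
  rw [Matrix.one_fin_three]
  simp only [Matrix.smul_of, Matrix.smul_cons, smul_eq_mul, Matrix.smul_empty, ← T_add,
    mul_zero, mul_one]
  norm_num [T_zero]

/-- `X ∈ GL(3, 𝔽₂[t,t⁻¹])`, the mod-2 reduced Burau image of `σ₁σ₂σ₃`. -/
def X : GL (Fin 3) R2 := ⟨Xmat, Xmatinv, Xmat_mul_Xmatinv, Xmatinv_mul_Xmat⟩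

/-- `Y ∈ GL(3, 𝔽₂[t,t⁻¹])`, the mod-2 reduced Burau image of `σ₁σ₂σ₃σ₁`. -/
def Y : GL (Fin 3) R2 := ⟨Ymat, Ymatinv, Ymat_mul_Ymatinv, Ymatinv_mul_Ymat⟩

/-- `PGL(3, R)`, the projective general linear group: `GL(3,R)` modulo its center
(the subgroup of scalars). -/
abbrev PGL3 : Type := GL (Fin 3) R2 ⧸ Subgroup.center (GL (Fin 3) R2)

/-- The natural projection `p : GL(3,R) → PGL(3,R)`. -/
def pp : GL (Fin 3) R2 →* PGL3 := QuotientGroup.mk' (Subgroup.center (GL (Fin 3) R2))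

/-- Relators of `Q₄ = ⟨x, y | x⁴ = y³ = 1, [x², yxy] = 1⟩`. -/
def q4Rels : Set (FreeGroup (Fin 2)) :=
  {(FreeGroup.of 0) ^ 4, (FreeGroup.of 1) ^ 3,
    br ((FreeGroup.of 0) ^ 2) (FreeGroup.of 1 * FreeGroup.of 0 * FreeGroup.of 1)}

/-- `Q₄ = B₄/Z(B₄)`, presented as `⟨x, y | x⁴ = y³ = 1, [x², yxy] = 1⟩`. -/
abbrev Q4 : Type := PresentedGroup q4Rels

/-- The generator `x` of `Q₄` (the class of `σ₁σ₂σ₃`). -/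
def qx : Q4 := PresentedGroup.of 0

/-- The generator `y` of `Q₄` (the class of `σ₁σ₂σ₃σ₁`). -/
def qy : Q4 := PresentedGroup.of 1

/-- `G`, the HNN extension of `Q₄` along the identity isomorphism of the subgroup `⟨yxy⟩`. -/
abbrev GrpG : Type :=
  HNNExtension Q4 (Subgroup.zpowers (qy * qx * qy)) (Subgroup.zpowers (qy * qx * qy))
    (MulEquiv.refl _)

/-- The canonical injection `ε : Q₄ ↪ G`. -/
def εQ : Q4 →* GrpG := HNNExtension.of

/-- The stable letter `t` of the HNN extension `G`. -/
def tG : GrpG := HNNExtension.t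

set_option linter.all false

lemma two_R2 : (2 : R2) = 0 := CharTwo.two_eq_zero

def tt : R2 := T 1
def ti : R2 := T (-1)
lemma tt_ti : tt * ti = 1 := by rw [tt, ti, ← T_add]; exact T_zero
lemma ti_tt : ti * tt = 1 := by rw [mul_comm]; exact tt_ti

def Tu (k : ℤ) : R2ˣ := ⟨T k, T (-k), by rw [← T_add, add_neg_cancel, T_zero], by rw [← T_add, neg_add_cancel, T_zero]⟩

lemma Tu_add (a b : ℤ) : Tu (a + b) = Tu a * Tu b := Units.ext (T_add a b)

def scal (k : ℤ) : GL (Fin 3) R2 := Units.map (Matrix.scalar (Fin 3)).toMonoidHom (Tu k)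

lemma scal_val (k : ℤ) : (scal k).val = Matrix.scalar (Fin 3) (T k) := rfl

lemma scal_mul_val (k : ℤ) (M : Matrix (Fin 3) (Fin 3) R2) : (scal k).val * M = (T k : R2) • M := by
  rw [scal_val, Matrix.scalar_apply, ← Matrix.smul_eq_diagonal_mul]

lemma scal_add (a b : ℤ) : scal (a + b) = scal a * scal b := by rw [scal, Tu_add, map_mul]; rfl

lemma scal_zero : scal 0 = 1 := by
  have := scal_add 0 0
  rw [add_zero] at this; exact (left_eq_mul.mp this)

lemma scal_central (k : ℤ) (g : GL (Fin 3) R2) : scal k * g = g * scal k := by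
  apply Units.ext
  rw [Units.val_mul, Units.val_mul, scal_val]
  exact (Matrix.scalar_commute (T k) (fun r' => Commute.all _ _) g.val)

lemma scal_mem_center (k : ℤ) : scal k ∈ Subgroup.center (GL (Fin 3) R2) := by
  rw [Subgroup.mem_center_iff]; intro g; exact (scal_central k g).symm

def Xn : GL (Fin 3) R2 := ⟨!![0,0,1; 1,0,1; 0,1,1], !![1,1,0; 1,0,1; 1,0,0],
  by refine Matrix.ext fun i j => ?_; fin_cases i <;> fin_cases j <;> simp [Matrix.mul_apply, Fin.sum_univ_three, CharTwo.add_self_eq_zero],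
  by refine Matrix.ext fun i j => ?_; fin_cases i <;> fin_cases j <;> simp [Matrix.mul_apply, Fin.sum_univ_three, CharTwo.add_self_eq_zero]⟩

def Yn : GL (Fin 3) R2 := scal (-1) * Y

lemma Yn_val : Yn.val = !![0,0,1; tt,1,1; 0,1,1] := by
  rw [Yn, Units.val_mul, scal_mul_val]
  change (T (-1) : R2) • ((T 1 : R2) • _) = _
  rw [smul_smul, ← T_add]
  simp [tt]

lemma X_eq : X = scal 1 * Xn := by
  apply Units.ext; rw [Units.val_mul, scal_mul_val]; rfl

lemma Y_eq : Y = scal 1 * Yn := by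
  rw [Yn, ← mul_assoc, ← scal_add, add_neg_cancel, scal_zero, one_mul]

lemma pp_scal (k : ℤ) : pp (scal k) = 1 := by
  rw [pp, QuotientGroup.mk'_apply, QuotientGroup.eq_one_iff]; exact scal_mem_center k

lemma pp_X : pp X = pp Xn := by rw [X_eq, map_mul, pp_scal, one_mul]
lemma pp_Y : pp Y = pp Yn := by rw [Y_eq, map_mul, pp_scal, one_mul]

/-! easy direction -/

def cm : Matrix (Fin 3) (Fin 3) R2 :=
  !![tt^4, 1, 1; tt^3+tt^4, tt+tt^2, tt^3+tt^4; tt, 1+tt^2+tt^3, 1+tt+tt^4]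

lemma Wn_val : (Yn * Xn * Yn).val = !![tt,0,0;tt,1+tt,tt;tt,1,0] := by
  rw [Units.val_mul, Units.val_mul, Yn_val]
  have h2 := two_R2
  refine Matrix.ext fun i j => ?_; fin_cases i <;> fin_cases j <;>
   simp [Xn, Matrix.mul_apply, Fin.sum_univ_three] <;> grind

lemma cm_comm : cm * (Yn * Xn * Yn).val = (Yn * Xn * Yn).val * cm := by
  rw [Wn_val]
  have h2 := two_R2
  refine Matrix.ext fun i j => ?_; fin_cases i <;> fin_cases j <;>
   simp [cm, Matrix.mul_apply, Fin.sum_univ_three] <;> grind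

lemma cm_rel : Xn.val * (Yn * Xn * Yn).val * cm * Xn.val = (Yn * Xn * Yn).val * Xn.val * cm := by
  rw [Wn_val]
  have h2 := two_R2
  refine Matrix.ext fun i j => ?_; fin_cases i <;> fin_cases j <;>
   simp [cm, Xn, Matrix.mul_apply, Fin.sum_univ_three] <;> grind

lemma cm_det : cm.det = tt^2*(1+tt)^9 := by
  have h2 := two_R2
  rw [Matrix.det_fin_three]
  simp [cm]; grind


abbrev LL : Type := FractionRing R2
abbrev PGLL : Type := GL (Fin 3) LL ⧸ Subgroup.center (GL (Fin 3) LL)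

def fL : R2 →+* LL := algebraMap R2 LL
lemma fL_inj : Function.Injective fL := IsFractionRing.injective R2 LL

def mL : GL (Fin 3) R2 →* GL (Fin 3) LL := Matrix.GeneralLinearGroup.map fL

lemma mL_val (g : GL (Fin 3) R2) : (mL g).val = g.val.map fL := rfl

lemma one_add_tt_ne : (1 + tt : R2) ≠ 0 := by
  intro h
  have := congrArg (fun f : R2 => f.coeff 1) h
  simp [tt, ← T_zero] at this

lemma tt_ne : tt ≠ 0 := fun h => one_ne_zero (α := R2) (by rw [← tt_ti, h, zero_mul])

def cL : GL (Fin 3) LL := Matrix.GeneralLinearGroup.mkOfDetNeZero (cm.map fL) (by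
  have : (cm.map fL).det = fL cm.det := (RingHom.map_det fL cm).symm
  rw [this, cm_det]
  intro h
  rw [← map_zero fL] at h
  have := fL_inj h
  simp [tt_ne, one_add_tt_ne] at this)

lemma cL_val : cL.val = cm.map fL := rfl

lemma cL_comm : cL * mL (Yn * Xn * Yn) = mL (Yn * Xn * Yn) * cL := by
  apply Units.ext
  rw [Units.val_mul, Units.val_mul, cL_val, mL_val, ← Matrix.map_mul, ← Matrix.map_mul, cm_comm]

lemma cL_rel : mL Xn * mL (Yn * Xn * Yn) * cL * mL Xn = mL (Yn * Xn * Yn) * mL Xn * cL := by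
  apply Units.ext
  simp only [Units.val_mul, cL_val, mL_val, ← Matrix.map_mul]
  have := cm_rel
  simp only [Units.val_mul] at this
  rw [this]

def prL : GL (Fin 3) LL →* PGLL := QuotientGroup.mk' _

def PmL : PGL3 →* PGLL := QuotientGroup.map _ _ mL (Matrix.GeneralLinearGroup.map_center_le fL)

lemma PmL_pp (g : GL (Fin 3) R2) : PmL (pp g) = prL (mL g) := rfl

lemma PmL_inj (z : PGL3) (h : PmL z = 1) : z = 1 := by
  obtain ⟨g, rfl⟩ := QuotientGroup.mk'_surjective _ z
  change prL (mL g) = 1 at h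
  rw [prL, QuotientGroup.mk'_apply, QuotientGroup.eq_one_iff, Subgroup.mem_center_iff] at h
  rw [QuotientGroup.mk'_apply, QuotientGroup.eq_one_iff, Subgroup.mem_center_iff]
  intro k
  have := h (mL k)
  rw [← map_mul, ← map_mul] at this
  apply Units.ext
  have h2 := congrArg Units.val this
  rw [mL_val, mL_val] at h2
  exact Matrix.map_injective fL_inj h2

theorem easy_dir (γ : Q4 →* PGL3) (hγx : γ qx = pp X) (hγy : γ qy = pp Y) (q : Q4)
   (h : εQ q ∈ Subgroup.normalClosure
        {br (εQ (qy * qx * qy)) (εQ qx) * tG * (εQ qx)⁻¹ * tG⁻¹}) : γ q = 1 := by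
  apply PmL_inj
  rw [pp_X] at hγx
  rw [pp_Y] at hγy
  have hw : PmL (γ (qy * qx * qy)) = prL (mL (Yn * Xn * Yn)) := by
    simp only [map_mul, hγx, hγy, PmL_pp]
  have hc : prL cL * PmL (γ (qy * qx * qy)) = PmL (γ (qy * qx * qy)) * prL cL := by
    rw [hw, ← map_mul, cL_comm, map_mul]
  let δ : GrpG →* PGLL := HNNExtension.lift (PmL.comp γ) (prL cL) (by
    rintro ⟨a, ha⟩
    obtain ⟨n, rfl⟩ := Subgroup.mem_zpowers_iff.mp ha
    change prL cL * PmL (γ ((qy * qx * qy)^n)) = PmL (γ ((qy * qx * qy)^n)) * prL cL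
    rw [map_zpow, map_zpow]
    exact Commute.zpow_right hc n)
  have hδε : ∀ q, δ (εQ q) = PmL (γ q) := fun q => HNNExtension.lift_of _ _ _ _
  have hδt : δ tG = prL cL := HNNExtension.lift_t _ _ _
  have hN : Subgroup.normalClosure
        {br (εQ (qy * qx * qy)) (εQ qx) * tG * (εQ qx)⁻¹ * tG⁻¹} ≤ δ.ker := by
    apply Subgroup.normalClosure_le_normal
    rw [Set.singleton_subset_iff]
    change δ _ = 1
    simp only [br, map_mul δ, map_inv δ, hδε, hδt, hw, hγx, PmL_pp]
    simp only [← map_inv prL, ← map_mul prL]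
    convert map_one prL
    have := cL_rel
    set x := mL Xn
    set w := mL (Yn * Xn * Yn)
    calc w⁻¹ * x⁻¹ * w * x * cL * x⁻¹ * cL⁻¹ = w⁻¹ * x⁻¹ * (w * x * cL) * x⁻¹ * cL⁻¹ := by group
      _ = w⁻¹ * x⁻¹ * (x * w * cL * x) * x⁻¹ * cL⁻¹ := by rw [this]
      _ = 1 := by group
  rw [← hδε]
  exact hN h


section PLemma
variable {G : Type*} [Group G]

def eN (x w : G) (n : ℕ) : G := (w ^ n)⁻¹ * x * w ^ n
def bN (x w : G) (n : ℕ) : G := x⁻¹ * (eN x w n)⁻¹ * x * eN x w n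
def zN (x T : G) (n : ℕ) : G := T ^ n * x ^ 2 * (T ^ n)⁻¹
def HN (x T : G) (n : ℕ) : Subgroup G := Subgroup.closure {v | ∃ i < n, v = zN x T i}

structure PH (x w T : G) : Prop where
  x4 : x ^ 4 = 1
  xw : Commute (x ^ 2) w
  Tw : Commute T w
  Tx : T * x * T⁻¹ = w⁻¹ * x⁻¹ * w * x

structure Good (x w : G) (v : G) : Prop where
  mem : v ∈ Subgroup.closure {x, w}
  cx : Commute v x
  cw : Commute v w
  sq : v * v = 1

lemma Good.comm {x w v : G} (h : Good x w v) {u : G} (hu : u ∈ Subgroup.closure {x, w}) : Commute v u := by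
  induction hu using Subgroup.closure_induction with
  | mem u hu => rcases hu with rfl | rfl; exacts [h.cx, h.cw]
  | one => exact Commute.one_right _
  | mul a b _ _ ha hb => exact ha.mul_right hb
  | inv a _ ha => exact ha.inv_right

lemma Good.mul {x w v u : G} (h : Good x w v) (h' : Good x w u) : Good x w (v * u) :=
  ⟨mul_mem h.mem h'.mem, h.cx.mul_left h'.cx, h.cw.mul_left h'.cw, by
    have := (h.comm h'.mem).eq
    calc v * u * (v * u) = v * (u * v) * u := by group
      _ = (v * v) * (u * u) := by rw [← this]; group
      _ = 1 := by rw [h.sq, h'.sq, one_mul]⟩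

lemma Good.one {x w : G} : Good x w 1 :=
  ⟨one_mem _, Commute.one_left _, Commute.one_left _, by simp⟩

lemma Good.inv {x w v : G} (h : Good x w v) : Good x w v⁻¹ := by
  have : v⁻¹ = v := by rw [inv_eq_iff_mul_eq_one]; exact h.sq
  rwa [this]

lemma good_HN {x w T : G} {n : ℕ} (h : ∀ i < n, Good x w (zN x T i)) {v : G} (hv : v ∈ HN x T n) :
    Good x w v := by
  induction hv using Subgroup.closure_induction with
  | mem u hu => obtain ⟨i, hi, rfl⟩ := hu; exact h i hi
  | one => exact Good.one
  | mul a b _ _ ha hb => exact ha.mul hb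
  | inv a _ ha => exact ha.inv

lemma eN_zero (x w : G) : eN x w 0 = x := by simp [eN]
lemma eN_succ (x w : G) (n : ℕ) : eN x w (n+1) = w⁻¹ * eN x w n * w := by
  simp only [eN, pow_succ]; group
lemma eN_mem (x w : G) (n : ℕ) : eN x w n ∈ Subgroup.closure {x, w} := by
  have hx : x ∈ Subgroup.closure {x, w} := Subgroup.subset_closure (by simp)
  have hw : w ∈ Subgroup.closure {x, w} := Subgroup.subset_closure (by simp)
  exact mul_mem (mul_mem (inv_mem (pow_mem hw n)) hx) (pow_mem hw n)

lemma bN_zero (x w : G) : bN x w 0 = 1 := by simp [bN, eN_zero]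

lemma zN_succ (x T : G) (n : ℕ) : zN x T (n+1) = T * zN x T n * T⁻¹ := by
  simp only [zN, pow_succ']; group
lemma zN_zero (x T : G) : zN x T 0 = x ^ 2 := by simp [zN]

lemma HN_mono (x T : G) {m n : ℕ} (h : m ≤ n) : HN x T m ≤ HN x T n :=
  Subgroup.closure_mono (fun v ⟨i, hi, e⟩ => ⟨i, by omega, e⟩)

lemma zN_mem (x T : G) {i n : ℕ} (h : i < n) : zN x T i ∈ HN x T n :=
  Subgroup.subset_closure ⟨i, h, rfl⟩

lemma HN_conj (x T : G) {n : ℕ} {v : G} (hv : v ∈ HN x T n) : T * v * T⁻¹ ∈ HN x T (n+1) := by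
  induction hv using Subgroup.closure_induction with
  | mem u hu => obtain ⟨i, hi, rfl⟩ := hu; rw [← zN_succ]; exact zN_mem x T (by omega)
  | one => simp
  | mul a b _ _ ha hb => rw [← conj_mul]; exact mul_mem ha hb
  | inv a _ ha => rw [← conj_inv]; exact inv_mem ha

variable {x w T : G}

lemma conj_mem_P (h : PH x w T) {v : G} (hv : v ∈ Subgroup.closure {x, w}) : T * v * T⁻¹ ∈ Subgroup.closure {x, w} := by
  have hx : x ∈ Subgroup.closure {x, w} := Subgroup.subset_closure (by simp)
  have hw : w ∈ Subgroup.closure {x, w} := Subgroup.subset_closure (by simp)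
  induction hv using Subgroup.closure_induction with
  | mem u hu =>
    rcases hu with rfl | rfl
    · rw [h.Tx]; exact mul_mem (mul_mem (mul_mem (inv_mem hw) (inv_mem hx)) hw) hx
    · rw [h.Tw.eq, mul_inv_cancel_right]; exact hw
  | one => simp
  | mul a b _ _ ha hb => rw [← conj_mul]; exact mul_mem ha hb
  | inv a _ ha => rw [← conj_inv]; exact inv_mem ha

lemma PH.z0good (h : PH x w T) : Good x w (x ^ 2) := by
  refine ⟨pow_mem (Subgroup.subset_closure (by simp)) 2, (Commute.refl x).pow_left 2, h.xw, ?_⟩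
  rw [← pow_add]; exact h.x4

lemma PH.zmem (h : PH x w T) (n : ℕ) : zN x T n ∈ Subgroup.closure {x, w} := by
  induction n with
  | zero => rw [zN_zero]; exact h.z0good.mem
  | succ n ih => rw [zN_succ]; exact conj_mem_P h ih

lemma PH.zsq (h : PH x w T) (n : ℕ) : zN x T n * zN x T n = 1 := by
  rw [zN, conj_mul, h.z0good.sq]; simp

lemma PH.zw (h : PH x w T) (n : ℕ) : Commute (zN x T n) w := by
  have h1 : Commute (T ^ n) w := h.Tw.pow_left n
  exact (h1.mul_left h.xw).mul_left h1.inv_left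

lemma PH.esq (h : PH x w T) (n : ℕ) : eN x w n * eN x w n = x ^ 2 := by
  have h1 : Commute (x^2) (w ^ n) := h.xw.pow_right n
  calc eN x w n * eN x w n = (w ^ n)⁻¹ * (x ^ 2 * w ^ n) := by simp only [eN, pow_two]; group
    _ = x ^ 2 := by rw [h1.eq]; group

lemma PH.einv (h : PH x w T) (n : ℕ) : (eN x w n)⁻¹ = x ^ 2 * eN x w n := by
  rw [inv_eq_iff_mul_eq_one, ← mul_assoc, ← (h.z0good.comm (eN_mem x w n)).eq, mul_assoc, h.esq,
    h.z0good.sq]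

/-- x inverts b -/
lemma PH.binv (h : PH x w T) (n : ℕ) : bN x w n * (x⁻¹ * bN x w n * x) = 1 := by
  have hc := (h.z0good.comm (eN_mem x w n)).eq
  have h1 := h.einv n
  have h2 := h.esq n
  have h4 : x ^ 4 = 1 := h.x4
  rw [bN]
  generalize eN x w n = v at *
  have hx : x⁻¹ = x ^ 3 := by rw [inv_eq_iff_mul_eq_one, ← pow_succ', h4]
  calc x⁻¹ * v⁻¹ * x * v * (x⁻¹ * (x⁻¹ * v⁻¹ * x * v) * x)
      = x⁻¹ * v⁻¹ * x * (v * (x^2)⁻¹) * v⁻¹ * x * v * x := by group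
    _ = x⁻¹ * v⁻¹ * x * ((x^2)⁻¹ * v) * v⁻¹ * x * v * x := by
        congr 5
        exact ((show Commute (x^2) v from hc).inv_left).eq.symm
    _ = x⁻¹ * (v⁻¹ * v) * x := by group
    _ = 1 := by group

lemma PH.conjT_e (h : PH x w T) (n : ℕ) : T * eN x w n * T⁻¹ = (eN x w (n+1))⁻¹ * eN x w n := by
  have h1 : Commute T (w ^ n) := h.Tw.pow_right n
  calc T * eN x w n * T⁻¹ = (T * (w^n)⁻¹ * T⁻¹) * (T * x * T⁻¹) * (T * w ^ n * T⁻¹) := by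
        simp only [eN]; group
    _ = (w^n)⁻¹ * (w⁻¹ * x⁻¹ * w * x) * w ^ n := by
        rw [h.Tx, h1.inv_right.eq, h1.eq]; group
    _ = _ := by simp only [eN, pow_succ']; group

lemma PH.base (h : PH x w T) : Good x w (zN x T 1) ∧ bN x w 1 = zN x T 1 := by
  have hz : zN x T 1 = x⁻¹ * bN x w 1 * x := by
    rw [zN_succ, zN_zero, pow_two, ← conj_mul, h.Tx]
    have h1 := h.einv 1
    have h2 := h.esq 1
    have hc := (h.z0good.comm (eN_mem x w 1)).eq
    have e1 : w⁻¹ * x⁻¹ * w * x = (eN x w 1)⁻¹ * x := by simp only [eN]; group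
    rw [e1, bN]
    generalize eN x w 1 = v at *
    have hx : x ^ 2 * x ^ 2 = 1 := h.z0good.sq
    have hc' : (x^2)⁻¹ * v⁻¹ = v⁻¹ * (x^2)⁻¹ := ((show Commute (x^2) v from hc).inv_left).inv_right.eq
    calc v⁻¹ * x * (v⁻¹ * x) = v⁻¹ * x * (x ^ 2 * v * x) := by rw [h1]
      _ = v⁻¹ * (x ^ 2 * x ^ 2) * x⁻¹ * v * x := by group
      _ = v⁻¹ * x⁻¹ * v * x := by rw [hx, mul_one]
      _ = v⁻¹ * (x ^ 2)⁻¹ * x * v * x := by group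
      _ = (x ^ 2)⁻¹ * v⁻¹ * x * v * x := by rw [hc']
      _ = _ := by group
  have hb := h.binv 1
  rw [← hz] at hb
  have hb' : bN x w 1 = zN x T 1 := by
    rw [eq_inv_of_mul_eq_one_left hb, inv_eq_iff_mul_eq_one]; exact h.zsq 1
  refine ⟨⟨h.zmem 1, ?_, h.zw 1, h.zsq 1⟩, hb'⟩
  rw [hb'] at hz
  change _ * _ = _ * _
  conv_rhs => rw [hz]
  group

lemma PH.step (h : PH x w T) (k : ℕ) (hg : ∀ i < k + 2, Good x w (zN x T i))
    (hb : bN x w k ∈ HN x T (k+1)) (hb2 : ∃ y ∈ HN x T (k+1), bN x w (k+1) = zN x T (k+1) * y) :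
    Good x w (zN x T (k+2)) ∧ ∃ y ∈ HN x T (k+2), bN x w (k+2) = zN x T (k+2) * y := by
  obtain ⟨y, hy, hby⟩ := hb2
  have gbk : Good x w (bN x w k) := good_HN hg (HN_mono x T (by omega) hb)
  have hb1 : bN x w (k+1) ∈ HN x T (k+2) := by
    rw [hby]; exact mul_mem (zN_mem x T (by omega)) (HN_mono x T (by omega) hy)
  have gbk1 : Good x w (bN x w (k+1)) := good_HN hg hb1
  set z := zN x T (k+2) with hz
  -- apply conjugation by T
  have e1 : br ((eN x w 1)⁻¹ * x) ((eN x w (k+2))⁻¹ * eN x w (k+1)) = z * (T * y * T⁻¹) := by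
    have h0 := h.conjT_e 0
    rw [eN_zero] at h0
    rw [hz, zN_succ, conj_mul, ← hby, ← h0, ← h.conjT_e (k+1), br, bN]
    group
  set y1 := T * y * T⁻¹ with hy1
  have hy1m : y1 ∈ HN x T (k+2) := HN_conj x T hy
  have gz0 := h.z0good
  set E1 := eN x w 1 with hE1
  set Ek := eN x w (k+1) with hEk
  set El := eN x w (k+2) with hEl
  have mE1 : E1 ∈ Subgroup.closure {x, w} := eN_mem x w 1
  have mEk : Ek ∈ Subgroup.closure {x, w} := eN_mem x w (k+1)
  have mEl : El ∈ Subgroup.closure {x, w} := eN_mem x w (k+2)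
  have mx : x ∈ Subgroup.closure {x, w} := Subgroup.subset_closure (by simp)
  have mw : w ∈ Subgroup.closure {x, w} := Subgroup.subset_closure (by simp)
  have e2 : br (E1⁻¹ * x) (El⁻¹ * Ek) = br (E1 * x) (El * Ek) := by
    rw [h.einv 1, h.einv (k+2), mul_assoc, mul_assoc]
    have c1 := gz0.comm (mul_mem mE1 mx)
    have c2 := gz0.comm (mul_mem mEl mEk)
    change Commute (x^2) (E1 * x) at c1
    change br (x ^ 2 * (E1 * x)) (x ^ 2 * (El * Ek)) = _
    generalize E1 * x = A at *
    generalize El * Ek = D at *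
    have hs := gz0.sq
    generalize x ^ 2 = u at *
    simp only [br, _root_.mul_inv_rev]
    have hu : u⁻¹ = u := by rw [inv_eq_iff_mul_eq_one]; exact hs
    rw [hu]
    calc A⁻¹ * u * (D⁻¹ * u) * (u * A) * (u * D) = A⁻¹ * (u * D⁻¹) * (u * u) * (A * u) * D := by group
      _ = A⁻¹ * (D⁻¹ * u) * (u * A) * D := by rw [hs, ← c1.eq, c2.inv_right.eq]; group
      _ = A⁻¹ * D⁻¹ * (u * u) * A * D := by group
      _ = _ := by rw [hs, mul_one]
  have b1 : br E1 Ek = bN x w k := by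
    have : br E1 Ek = w⁻¹ * bN x w k * w := by
      rw [hE1, hEk, eN_succ, eN_succ, eN_zero, br, bN]; group
    rw [this, mul_assoc, gbk.cw.eq]; group
  have b2 : br E1 El = bN x w (k+1) := by
    have : br E1 El = w⁻¹ * bN x w (k+1) * w := by
      rw [hE1, hEl, eN_succ, eN_succ x w (k+1), eN_zero, br, bN]; group
    rw [this, mul_assoc, gbk1.cw.eq]; group
  have e3 : br (E1 * x) (El * Ek) = x⁻¹ * (br E1 Ek * (Ek⁻¹ * br E1 El * Ek)) * x * (bN x w (k+1) * (Ek⁻¹ * bN x w (k+2) * Ek)) := by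
    simp only [br, bN, ← hEk, ← hEl]; group
  have c1 : Ek⁻¹ * bN x w (k+1) * Ek = bN x w (k+1) := by
    rw [mul_assoc, (gbk1.comm mEk).eq]; group
  rw [b1, b2, c1] at e3
  have c2 : x⁻¹ * (bN x w k * bN x w (k+1)) * x = bN x w k * bN x w (k+1) := by
    rw [mul_assoc, (gbk.mul gbk1).cx.eq]; group
  rw [c2] at e3
  have e4 : bN x w k * (Ek⁻¹ * bN x w (k+2) * Ek) = z * y1 := by
    rw [← e1, e2, e3]
    calc _ = bN x w k * 1 * (Ek⁻¹ * bN x w (k+2) * Ek) := by rw [mul_one]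
      _ = _ := by rw [← gbk1.sq]; group
  -- solve
  have gy1 : Good x w y1 := good_HN hg hy1m
  set y' := y1 * bN x w k with hy'
  have gy' : Good x w y' := gy1.mul gbk
  have my' : y' ∈ HN x T (k+2) := mul_mem hy1m (HN_mono x T (by omega) hb)
  have mz : z ∈ Subgroup.closure {x, w} := h.zmem _
  have e5 : bN x w (k+2) = (Ek * z * Ek⁻¹) * y' := by
    have : Ek⁻¹ * bN x w (k+2) * Ek = z * y' := by
      have e6 : Ek⁻¹ * bN x w (k+2) * Ek = (bN x w k)⁻¹ * (z * y1) := by rw [← e4]; group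
      have e7 : (bN x w k)⁻¹ = bN x w k := by rw [inv_eq_iff_mul_eq_one]; exact gbk.sq
      rw [e6, e7, (gbk.comm (mul_mem mz gy1.mem)).eq, mul_assoc]
    calc _ = Ek * (Ek⁻¹ * bN x w (k+2) * Ek) * Ek⁻¹ := by group
      _ = Ek * z * (y' * Ek⁻¹) := by rw [this]; group
      _ = _ := by rw [(gy'.comm (inv_mem mEk)).eq]; group
  set ζ := x * z * x⁻¹ with hζ
  have hzw : Commute z w := h.zw _
  have hzx1 : Commute z (E1⁻¹ * x) := by
    have h0 := h.conjT_e 0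
    rw [eN_zero] at h0
    have hc := (hg (k+1) (by omega)).cx
    rw [← h0, hz, zN_succ]
    exact (Commute.conj_iff T).mpr hc
  have hζw : Commute ζ w := by
    have : w⁻¹ * ζ * w = ζ := by
      have a1 : w⁻¹ * ζ * w = E1 * (w⁻¹ * z * w) * E1⁻¹ := by rw [hE1, eN_succ, eN_zero, hζ]; group
      have a2 : w⁻¹ * z * w = z := by rw [mul_assoc, hzw.eq]; group
      rw [a1, a2, hζ]
      calc E1 * z * E1⁻¹ = E1 * (z * (E1⁻¹ * x)) * x⁻¹ := by group
        _ = x * z * x⁻¹ := by rw [hzx1.eq]; group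
    change _ * _ = _ * _
    conv_rhs => rw [← this]
    group
  have e6 : Ek * z * Ek⁻¹ = ζ := by
    have hzw' : Commute z (w ^ (k+1)) := hzw.pow_right _
    have hζw' : Commute ζ (w ^ (k+1)) := hζw.pow_right _
    calc Ek * z * Ek⁻¹ = (w ^ (k+1))⁻¹ * x * (w ^ (k+1) * z) * (w ^ (k+1))⁻¹ * x⁻¹ * w ^ (k+1) := by
            rw [hEk, eN]; group
      _ = (w ^ (k+1))⁻¹ * (ζ * w ^ (k+1)) := by rw [← hzw'.eq, hζ]; group
      _ = _ := by rw [hζw'.eq]; group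
  rw [e6] at e5
  have mζ : ζ ∈ Subgroup.closure {x, w} := mul_mem (mul_mem mx mz) (inv_mem mx)
  have ζsq : ζ * ζ = 1 := by rw [hζ, conj_mul, h.zsq]; simp
  have bsq : bN x w (k+2) * bN x w (k+2) = 1 := by
    rw [e5]
    calc ζ * y' * (ζ * y') = ζ * (y' * ζ) * y' := by group
      _ = (ζ * ζ) * (y' * y') := by rw [(gy'.comm mζ).eq]; group
      _ = 1 := by rw [ζsq, gy'.sq, mul_one]
  have bx : Commute (bN x w (k+2)) x := by
    have := h.binv (k+2)
    have h2 : x⁻¹ * bN x w (k+2) * x = bN x w (k+2) := by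
      rw [eq_inv_of_mul_eq_one_right this, inv_eq_iff_mul_eq_one]; exact bsq
    change _ * _ = _ * _
    conv_rhs => rw [← h2]
    group
  have ζx : Commute ζ x := by
    have : ζ = bN x w (k+2) * y'⁻¹ := by rw [e5]; group
    rw [this]; exact bx.mul_left gy'.cx.inv_left
  have zζ : ζ = z := by
    have : z = x⁻¹ * (ζ * x) := by rw [hζ]; group
    rw [this, ζx.eq]; group
  rw [zζ] at e5 ζx
  exact ⟨⟨mz, ζx, hzw, h.zsq _⟩, y', my', e5⟩

lemma PH.main (h : PH x w T) (k : ℕ) : (∀ i < k + 2, Good x w (zN x T i)) ∧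
    bN x w k ∈ HN x T (k+1) ∧ ∃ y ∈ HN x T (k+1), bN x w (k+1) = zN x T (k+1) * y := by
  induction k with
  | zero =>
    obtain ⟨h1, h2⟩ := h.base
    refine ⟨?_, by rw [bN_zero]; exact one_mem _, 1, one_mem _, by rw [mul_one]; exact h2⟩
    intro i hi
    interval_cases i
    · rw [zN_zero]; exact h.z0good
    · exact h1
  | succ k ih =>
    obtain ⟨h1, h2, h3⟩ := ih
    obtain ⟨h4, h5⟩ := h.step k h1 h2 h3
    refine ⟨?_, ?_, h5⟩
    · intro i hi
      rcases Nat.lt_or_ge i (k+2) with h | h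
      · exact h1 i h
      · rw [show i = k+2 by omega]; exact h4
    · obtain ⟨y, hy, e⟩ := h3
      rw [e]; exact mul_mem (zN_mem x T (by omega)) (HN_mono x T (by omega) hy)

lemma PH.goodb (h : PH x w T) (k : ℕ) : Good x w (bN x w k) :=
  good_HN (fun i hi => (h.main k).1 i (by omega)) (h.main k).2.1

end PLemma


def bar : R2 →+* R2 := (LaurentPolynomial.invert : LaurentPolynomial (ZMod 2) ≃ₐ[ZMod 2] LaurentPolynomial (ZMod 2)).toAlgHom.toRingHom

lemma bar_coeff (f : R2) (k : ℤ) : (bar f).coeff k = f.coeff (-k) := LaurentPolynomial.invert_apply f k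
lemma bar_T (k : ℤ) : bar (T k) = T (-k) := LaurentPolynomial.invert_T k
lemma bar_tt : bar tt = ti := bar_T 1
lemma bar_ti : bar ti = tt := by rw [ti, bar_T]; rfl
lemma bar_bar (f : R2) : bar (bar f) = f := by
  apply LaurentPolynomial.ext; intro k; rw [bar_coeff, bar_coeff, neg_neg]

abbrev M3 : Type := Matrix (Fin 3) (Fin 3) R2
abbrev GL3 : Type := GL (Fin 3) R2

def Um (α β : R2) : M3 := !![1, (1+tt)*bar α, β; 0, 1, α; 0, 0, 1]

structure IsU (g : GL3) (α β : R2) : Prop where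
  val : g.val = Um α β
  rel : β + tt * bar β = (1 + tt) * α * bar α

lemma Um_mul (a b a' b' : R2) : Um a b * Um a' b' = Um (a + a') (b + b' + (1+tt) * bar a * a') := by
  refine Matrix.ext fun i j => ?_; fin_cases i <;> fin_cases j <;>
   simp [Um, Matrix.mul_apply, Fin.sum_univ_three] <;> ring

lemma Um_zero : Um 0 0 = 1 := by
  refine Matrix.ext fun i j => ?_; fin_cases i <;> fin_cases j <;> simp [Um]

lemma bar_rel {α β : R2} (h : β + tt * bar β = (1 + tt) * α * bar α) :
   bar β + ti * β = (1 + ti) * bar α * α := by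
  have := congrArg bar h
  simpa [bar_bar, bar_tt] using this

lemma IsU.mul {g g' : GL3} {a b a' b' : R2} (h : IsU g a b) (h' : IsU g' a' b') :
    IsU (g * g') (a + a') (b + b' + (1+tt) * bar a * a') := by
  refine ⟨by rw [Units.val_mul, h.val, h'.val, Um_mul], ?_⟩
  have e1 := h.rel
  have e2 := h'.rel
  have := tt_ti
  have h2 := two_R2
  simp only [map_add, map_mul, map_one, bar_tt, bar_bar]
  linear_combination e1 + e2 + a * bar a' * this

lemma IsU.one : IsU 1 0 0 := ⟨by rw [Um_zero]; rfl, by simp⟩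

lemma IsU.inv {g : GL3} {a b : R2} (h : IsU g a b) : IsU g⁻¹ a (tt * bar b) := by
  have h2 := two_R2
  have h3 := tt_ti
  have e := h.rel
  constructor
  · have h1 : g.val * Um a (tt * bar b) = 1 := by
      rw [h.val, Um_mul, ← Um_zero]
      congr 1
      · linear_combination a * h2
      · linear_combination e + (1+tt)*a*bar a * h2
    calc (g⁻¹).val = (g⁻¹).val * (g.val * Um a (tt * bar b)) := by rw [h1, mul_one]
      _ = _ := by rw [← mul_assoc, Units.inv_mul, one_mul]
  · simp only [map_add, map_mul, map_one, bar_tt, bar_bar]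
    linear_combination e + b * h3

lemma IsU.ext {g g' : GL3} {a b : R2} (h : IsU g a b) (h' : IsU g' a b) : g = g' :=
  Units.ext (by rw [h.val, h'.val])

lemma IsU.uniq {g : GL3} {a b a' b' : R2} (h : IsU g a b) (h' : IsU g a' b') : a = a' ∧ b = b' := by
  have := h.val.symm.trans h'.val
  refine ⟨by simpa [Um] using congrFun (congrFun this 1) 2, by simpa [Um] using congrFun (congrFun this 0) 2⟩

def xg : GL3 := ⟨Um 1 tt, Um 1 1,
  by rw [Um_mul, ← Um_zero]; congr 1 <;> (try simp only [map_one]) <;> grind [two_R2],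
  by rw [Um_mul, ← Um_zero]; congr 1 <;> (try simp only [map_one]) <;> grind [two_R2]⟩

lemma xg_U : IsU xg 1 tt := ⟨rfl, by simp [bar_tt, tt_ti]; ring⟩
lemma xgi_U : IsU xg⁻¹ 1 1 := by
  have := xg_U.inv; rwa [bar_tt, tt_ti] at this

def Jg : GL3 := ⟨!![0,0,tt; 0,1,0; 1,0,0], !![0,0,1;0,1,0;ti,0,0],
  by refine Matrix.ext fun i j => ?_; fin_cases i <;> fin_cases j <;>
   simp [Matrix.mul_apply, Fin.sum_univ_three, tt_ti, ti_tt],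
  by refine Matrix.ext fun i j => ?_; fin_cases i <;> fin_cases j <;>
   simp [Matrix.mul_apply, Fin.sum_univ_three, tt_ti, ti_tt]⟩

def τg : GL3 := Jg * Jg

def Dm (a b c : R2) : M3 := !![a,0,0;0,b,0;0,0,c]

lemma Dm_mul (a b c a' b' c' : R2) : Dm a b c * Dm a' b' c' = Dm (a*a') (b*b') (c*c') := by
  refine Matrix.ext fun i j => ?_; fin_cases i <;> fin_cases j <;>
   simp [Dm, Matrix.mul_apply, Fin.sum_univ_three]

lemma Dm_one : Dm 1 1 1 = 1 := by
  refine Matrix.ext fun i j => ?_; fin_cases i <;> fin_cases j <;> simp [Dm]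

lemma τg_val : τg.val = Dm tt 1 tt := by
  rw [τg, Units.val_mul]
  refine Matrix.ext fun i j => ?_; fin_cases i <;> fin_cases j <;>
   simp [Dm, Jg, Matrix.mul_apply, Fin.sum_univ_three]

lemma GL_inv_val {g : GL3} {M : M3} (h : g.val * M = 1) : (g⁻¹).val = M := by
  calc (g⁻¹).val = (g⁻¹).val * (g.val * M) := by rw [h, mul_one]
      _ = _ := by rw [← mul_assoc, Units.inv_mul, one_mul]

lemma τg_zpow (k : ℤ) : (τg ^ k).val = Dm (T k) 1 (T k) := by
  induction k using Int.induction_on with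
  | zero => simp [Dm_one]
  | succ n ih =>
    rw [_root_.zpow_add_one, Units.val_mul, ih, τg_val, Dm_mul, tt, ← T_add, mul_one]
  | pred n ih =>
    have : (τg⁻¹).val = Dm ti 1 ti := GL_inv_val (by rw [τg_val, Dm_mul, tt_ti, mul_one, Dm_one])
    rw [_root_.zpow_sub_one, Units.val_mul, ih, this, Dm_mul, ti, ← T_add, mul_one]
    rfl

lemma scal_val' (k : ℤ) : (scal k).val = Dm (T k) (T k) (T k) := by
  rw [scal_val]
  refine Matrix.ext fun i j => ?_; fin_cases i <;> fin_cases j <;> simp [Dm]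

lemma Jg_τg (k : ℤ) : Jg * τg ^ k = τg ^ k * Jg := by
  have : Commute Jg τg := by change Jg * (Jg * Jg) = (Jg * Jg) * Jg; group
  exact (this.zpow_right k).eq

lemma conj_gen {R : Type*} [CommRing R] (p q A β α : R) :
    !![p,0,0;0,1,0;0,0,p] * !![1,A,β;0,1,α;0,0,1] * !![q,0,0;0,1,0;0,0,q] =
    !![p*q, p*A, p*β*q; 0,1,α*q;0,0,p*q] := by
  refine Matrix.ext fun i j => ?_; fin_cases i <;> fin_cases j <;>
      simp [Matrix.mul_apply, Fin.sum_univ_three]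

lemma IsU.conj_τ {g : GL3} {a b : R2} (h : IsU g a b) (k : ℤ) :
    IsU (τg ^ k * g * τg ^ (-k)) (T (-k) * a) b := by
  have e1 : (T k : R2) * T (-k) = 1 := by rw [← T_add, add_neg_cancel, T_zero]
  constructor
  · rw [Units.val_mul, Units.val_mul, h.val, τg_zpow, τg_zpow]
    rw [Dm, Dm, Um, conj_gen, Um, e1, map_mul, bar_T, neg_neg]
    have f1 : T k * ((1 + tt) * bar a) = (1 + tt) * (T k * bar a) := by ring
    have f2 : T k * b * T (-k) = b := by rw [mul_right_comm, e1, one_mul]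
    have f3 : a * T (-k) = T (-k) * a := mul_comm _ _
    rw [f1, f2, f3]
  · simp only [map_mul, bar_T, neg_neg]
    linear_combination h.rel - (1 + tt) * a * bar a * e1

/-- the braid-like relation (J x⁻¹)³ = t -/
lemma Jx3 : (Jg * xg⁻¹) ^ 3 = scal 1 := by
  apply Units.ext
  rw [pow_succ, pow_two]
  simp only [Units.val_mul]
  rw [xgi_U.val, scal_val']
  have h2 := two_R2
  refine Matrix.ext fun i j => ?_; fin_cases i <;> fin_cases j <;>
      simp [Um, Dm, Jg, Matrix.mul_apply, Fin.sum_univ_three] <;> (try rw [show (T 1 : R2) = tt from rfl]) <;> grind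


lemma addself (a : R2) : a + a = 0 := CharTwo.add_self_eq_zero a

def wg : GL3 := τg * xg⁻¹

lemma IsU.congr {g : GL3} {a b a' b' : R2} (h : IsU g a b) (ha : a = a') (hb : b = b') : IsU g a' b' := by
  subst ha; subst hb; exact h

lemma IsU.conj_wi {g : GL3} {a b : R2} (h : IsU g a b) : ∃ b', IsU (wg⁻¹ * g * wg) (tt * a) b' := by
  have h1 := h.conj_τ (-1)
  have h2 := (xg_U.mul h1).mul xgi_U
  have e : wg⁻¹ * g * wg = xg * (τg ^ (-1 : ℤ) * g * τg ^ (-(-1) : ℤ)) * xg⁻¹ := by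
    rw [wg]; simp only [neg_neg, _root_.zpow_neg_one, zpow_one]; group
  rw [e]
  refine ⟨_, h2.congr ?_ rfl⟩
  rw [neg_neg, show (T 1 : R2) = tt from rfl]
  linear_combination two_R2

lemma IsU.conj_w {g : GL3} {a b : R2} (h : IsU g a b) : ∃ b', IsU (wg * g * wg⁻¹) (ti * a) b' := by
  have h1 := ((xgi_U.mul h).mul xg_U).conj_τ 1
  have e : wg * g * wg⁻¹ = τg ^ (1 : ℤ) * (xg⁻¹ * g * xg) * τg ^ (-(1) : ℤ) := by
    rw [wg]; simp only [_root_.zpow_neg_one, zpow_one]; group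
  rw [e]
  refine ⟨_, h1.congr ?_ rfl⟩
  rw [show (T (-1) : R2) = ti from rfl]
  linear_combination ti * two_R2

lemma IsU.comm {g g' : GL3} {a b a' b' : R2} (h : IsU g a b) (h' : IsU g' a' b') :
    IsU (g⁻¹ * g'⁻¹ * g * g') 0 ((1+tt) * (bar a * a' + a * bar a')) := by
  have h1 := (h.inv.mul h'.inv).mul (h.mul h')
  rw [← mul_assoc] at h1
  refine h1.congr ?_ ?_
  · linear_combination (a + a') * two_R2
  · rw [map_add]
    linear_combination h.rel + h'.rel + ((1+tt)*(a*bar a + a'*bar a' + bar a * a')) * two_R2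

def eZ {G : Type*} [Group G] (x w : G) (j : ℤ) : G := w ^ (-j) * x * w ^ j

lemma eZ_nat {G : Type*} [Group G] (x w : G) (n : ℕ) : eZ x w n = eN x w n := by
  simp [eZ, eN]

lemma eZ_succ {G : Type*} [Group G] (x w : G) (j : ℤ) : eZ x w (j+1) = w⁻¹ * eZ x w j * w := by
  simp only [eZ]; group
lemma eZ_pred {G : Type*} [Group G] (x w : G) (j : ℤ) : eZ x w (j-1) = w * eZ x w j * w⁻¹ := by
  simp only [eZ]; group

lemma eZ_U (j : ℤ) : ∃ b, IsU (eZ xg wg j) (T j) b := by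
  induction j using Int.induction_on with
  | zero => exact ⟨tt, by simpa [eZ] using xg_U⟩
  | succ n ih =>
    obtain ⟨b, hb⟩ := ih
    obtain ⟨b', hb'⟩ := hb.conj_wi
    rw [eZ_succ]
    exact ⟨b', hb'.congr (by rw [tt, ← T_add, add_comm]) rfl⟩
  | pred n ih =>
    obtain ⟨b, hb⟩ := ih
    obtain ⟨b', hb'⟩ := hb.conj_w
    rw [eZ_pred]
    exact ⟨b', hb'.congr (by rw [ti, ← T_add]; congr 1; ring) rfl⟩

lemma bN_U (n : ℕ) : IsU (bN xg wg n) 0 ((1+tt) * (T n + T (-n))) := by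
  obtain ⟨b, hb⟩ := eZ_U n
  rw [eZ_nat] at hb
  refine (xg_U.comm hb).congr rfl ?_
  rw [map_one, bar_T, one_mul, one_mul]

lemma xsq_U : IsU (xg ^ 2) 0 (1 + tt) := by
  rw [pow_two]
  refine (xg_U.mul xg_U).congr (addself 1) ?_
  rw [map_one]; linear_combination tt * two_R2

/-- central elements -/
lemma U0_comm {g g' : GL3} {a b b' : R2} (h : IsU g 0 b) (h' : IsU g' a b') : Commute g g' := by
  refine IsU.ext (h.mul h') ((h'.mul h).congr ?_ ?_)
  · ring
  · rw [map_zero]; ring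

lemma U0_τ {g : GL3} {b : R2} (h : IsU g 0 b) (k : ℤ) : Commute g (τg ^ k) := by
  have := h.conj_τ k
  rw [mul_zero] at this
  have e := this.ext h
  change g * τg ^ k = _
  conv_lhs => rw [← e]
  group

lemma U0_w {g : GL3} {b : R2} (h : IsU g 0 b) : Commute g wg := by
  have := U0_τ h 1
  rw [zpow_one] at this
  exact this.mul_right (U0_comm h xg_U).inv_right

lemma U0_sq {g : GL3} {b : R2} (h : IsU g 0 b) : g * g = 1 := by
  refine IsU.ext (h.mul h) (IsU.one.congr ?_ ?_)
  · ring
  · rw [map_zero, addself]; ring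

structure QH {Q : Type*} [Group Q] (x y t : Q) : Prop where
  x4 : x ^ 4 = 1
  y3 : y ^ 3 = 1
  xw : Commute (x ^ 2) (y * x * y)
  Tw : Commute t (y * x * y)
  Tx : t * x * t⁻¹ = (y * x * y)⁻¹ * x⁻¹ * (y * x * y) * x

lemma QH.ph {Q : Type*} [Group Q] {x y t : Q} (h : QH x y t) : PH x (y * x * y) t :=
  ⟨h.x4, h.xw, h.Tw, h.Tx⟩

section lists
variable {ι G : Type*} [Group G] [DecidableEq ι]

lemma list_move (f : ι → G) (Z : Subgroup G)
    (hZ : ∀ z ∈ Z, ∀ i, Commute z (f i)) 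
    (hc : ∀ i j, (f i)⁻¹ * (f j)⁻¹ * f i * f j ∈ Z) (a : ι) (s : List ι) :
    ∃ z ∈ Z, f a * (s.map f).prod = (s.map f).prod * f a * z := by
  induction s with
  | nil => exact ⟨1, one_mem _, by simp⟩
  | cons b s ih =>
    obtain ⟨z, hz, e⟩ := ih
    refine ⟨((f b)⁻¹ * (f a)⁻¹ * f b * f a)⁻¹ * z, mul_mem (inv_mem (hc b a)) hz, ?_⟩
    have hc1 : ∀ i, Commute ((f b)⁻¹ * (f a)⁻¹ * f b * f a)⁻¹ (f i) := fun i => hZ _ (inv_mem (hc b a)) i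
    have hcl : Commute ((f b)⁻¹ * (f a)⁻¹ * f b * f a)⁻¹ ((s.map f).prod * f a) := by
      refine Commute.mul_right ?_ (hc1 a)
      apply Commute.list_prod_right
      intro x hx
      obtain ⟨i, _, rfl⟩ := List.mem_map.mp hx
      exact hc1 i
    rw [List.map_cons, List.prod_cons]
    have e0 : f a * f b = f b * f a * ((f b)⁻¹ * (f a)⁻¹ * f b * f a)⁻¹ := by group
    generalize ((f b)⁻¹ * (f a)⁻¹ * f b * f a)⁻¹ = c at *
    calc f a * (f b * (s.map f).prod) = (f a * f b) * (s.map f).prod := by group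
      _ = f b * c * (f a * (s.map f).prod) := by
          rw [e0, mul_assoc (f b), ← (hc1 a).eq]; group
      _ = f b * (c * ((s.map f).prod * f a)) * z := by rw [e]; group
      _ = _ := by rw [hcl.eq]; group

lemma list_even (f : ι → G) (Z : Subgroup G)
    (hZ : ∀ z ∈ Z, ∀ i, Commute z (f i)) (hs : ∀ i, f i * f i ∈ Z)
    (hc : ∀ i j, (f i)⁻¹ * (f j)⁻¹ * f i * f j ∈ Z) : ∀ (n : ℕ) (l : List ι) (hn : l.length ≤ n)
    (he : ∀ i, Even (l.count i)), (l.map f).prod ∈ Z := by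
  intro n
  induction n with
  | zero => intro l hn _; rw [List.length_eq_zero_iff.mp (by omega : l.length = 0)]; simp
  | succ n ih =>
    intro l hn he
    cases l with
    | nil => simp
    | cons a l =>
      have h1 := he a
      rw [List.count_cons_self] at h1
      have hpos : 0 < l.count a := by
        rcases Nat.eq_zero_or_pos (l.count a) with h | h
        · rw [h] at h1; exact absurd h1 (by decide)
        · exact h
      obtain ⟨s, t, rfl⟩ := List.append_of_mem (List.count_pos_iff.mp hpos)
      have h2 : ((s ++ t).map f).prod ∈ Z := by
        apply ih
        · simp at hn ⊢; omega
        · intro i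
          have := he i
          rw [List.count_append]
          rw [List.count_cons, List.count_append, List.count_cons] at this
          split_ifs at this
          · rw [show s.count i + (t.count i + 1) + 1 = s.count i + t.count i + 2 by ring] at this
            exact (Nat.even_add.mp this).mpr (by decide)
          · simpa using this
      obtain ⟨z, hz, e⟩ := list_move f Z hZ hc a s
      rw [List.map_append, List.prod_append] at h2
      rw [List.map_cons, List.prod_cons, List.map_append, List.prod_append, List.map_cons, List.prod_cons]
      have e2 : f a * ((s.map f).prod * (f a * (t.map f).prod)) =
          (s.map f).prod * (((f a * f a) * z) * (t.map f).prod) := by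
        calc _ = (f a * (s.map f).prod) * (f a * (t.map f).prod) := by group
          _ = (s.map f).prod * f a * (z * f a) * (t.map f).prod := by rw [e]; group
          _ = _ := by rw [(hZ z hz a).eq]; group
      rw [e2]
      have hcz : Commute ((f a * f a) * z) (t.map f).prod := by
        apply Commute.list_prod_right
        intro x hx
        obtain ⟨i, _, rfl⟩ := List.mem_map.mp hx
        exact hZ _ (mul_mem (hs a) hz) i
      rw [hcz.eq, ← mul_assoc]
      exact mul_mem h2 (mul_mem (hs a) hz)
end lists


section pair
variable {Q : Type*} [Group Q]

def Xt (x : Q) : Q × GL3 := (x, xg)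
def Jt (x y : Q) : Q × GL3 := (y * x, Jg)
def τt (x y : Q) : Q × GL3 := Jt x y * Jt x y
def Ct (Q : Type*) [Group Q] : Q × GL3 := (1, scal 1)
def Wt (x y : Q) : Q × GL3 := (y * x * y, wg)

lemma Wt_eq (x y : Q) : Wt x y = τt x y * (Xt x)⁻¹ := by
  ext : 1
  · simp [Wt, τt, Jt, Xt, mul_assoc]
  · simp [Wt, τt, Jt, Xt, wg, τg]

def PP (x y : Q) : Subgroup (Q × GL3) := Subgroup.closure {Xt x, τt x y, Ct Q}

lemma Ct_comm (d : Q × GL3) : Commute (Ct Q) d := by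
  change _ * _ = _ * _
  ext : 1
  · simp [Ct]
  · exact scal_central 1 d.2

lemma scal_zpow (k : ℤ) : scal 1 ^ k = scal k := by
  induction k using Int.induction_on with
  | zero => simp [scal_zero]
  | succ n ih => rw [_root_.zpow_add_one, ih, scal_add]
  | pred n ih =>
    rw [_root_.zpow_sub_one, ih, eq_comm, eq_mul_inv_iff_mul_eq, ← scal_add]; congr 1; ring

lemma Ct_zpow (k : ℤ) : (Ct Q) ^ k = (1, scal k) := by
  ext : 1
  · simp [Ct]
  · simp [Ct, scal_zpow]

lemma eZ_fst (x w : Q × GL3) (j : ℤ) : (eZ x w j).1 = eZ x.1 w.1 j := rfl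
lemma eZ_snd (x w : Q × GL3) (j : ℤ) : (eZ x w j).2 = eZ x.2 w.2 j := rfl

variable {x y t : Q}

/-- normal form -/
lemma PP_nf (hq : QH x y t) {d : Q × GL3} (hd : d ∈ PP x y) : ∃ (c m : ℤ) (l : List ℤ),
    d = Ct Q ^ c * Wt x y ^ m * (l.map (eZ (Xt x) (Wt x y))).prod := by
  have hX : ∀ d : Q × GL3, (∃ (c m : ℤ) (l : List ℤ),
    d = Ct Q ^ c * Wt x y ^ m * (l.map (eZ (Xt x) (Wt x y))).prod) → (∃ (c m : ℤ) (l : List ℤ),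
    d * Xt x = Ct Q ^ c * Wt x y ^ m * (l.map (eZ (Xt x) (Wt x y))).prod) := by
    rintro d ⟨c, m, l, rfl⟩
    refine ⟨c, m, l ++ [0], ?_⟩
    simp [eZ, mul_assoc]
  have hX4 : (Xt x)⁻¹ = Xt x * Xt x * Xt x := by
    rw [inv_eq_iff_mul_eq_one]
    ext : 1
    · have := hq.x4; simp [Xt]; rw [← this]; simp only [pow_succ, pow_zero, one_mul, mul_assoc]
    · simp [Xt]
      have := U0_sq xsq_U
      rw [← this]; simp only [pow_succ, pow_zero, one_mul, mul_assoc]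
  have hX' : ∀ d : Q × GL3, (∃ (c m : ℤ) (l : List ℤ),
    d = Ct Q ^ c * Wt x y ^ m * (l.map (eZ (Xt x) (Wt x y))).prod) → (∃ (c m : ℤ) (l : List ℤ),
    d * (Xt x)⁻¹ = Ct Q ^ c * Wt x y ^ m * (l.map (eZ (Xt x) (Wt x y))).prod) := by
    intro d h
    rw [hX4, ← mul_assoc, ← mul_assoc]
    exact hX _ (hX _ (hX _ h))
  have lw : ∀ l : List ℤ, (l.map (eZ (Xt x) (Wt x y))).prod * Wt x y =
      Wt x y * ((l.map (· + 1)).map (eZ (Xt x) (Wt x y))).prod := by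
    intro l
    induction l with
    | nil => simp
    | cons a l ih =>
      simp only [List.map_cons, List.prod_cons]
      rw [mul_assoc, ih, eZ_succ]; group
  have lw' : ∀ l : List ℤ, (l.map (eZ (Xt x) (Wt x y))).prod * (Wt x y)⁻¹ =
      (Wt x y)⁻¹ * ((l.map (· - 1)).map (eZ (Xt x) (Wt x y))).prod := by
    intro l
    induction l with
    | nil => simp
    | cons a l ih =>
      simp only [List.map_cons, List.prod_cons]
      rw [mul_assoc, ih, eZ_pred]; group
  have hW : ∀ d : Q × GL3, (∃ (c m : ℤ) (l : List ℤ),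
    d = Ct Q ^ c * Wt x y ^ m * (l.map (eZ (Xt x) (Wt x y))).prod) → (∃ (c m : ℤ) (l : List ℤ),
    d * Wt x y = Ct Q ^ c * Wt x y ^ m * (l.map (eZ (Xt x) (Wt x y))).prod) := by
    rintro d ⟨c, m, l, rfl⟩
    refine ⟨c, m + 1, l.map (· + 1), ?_⟩
    rw [mul_assoc, lw, _root_.zpow_add_one]; group
  have hW' : ∀ d : Q × GL3, (∃ (c m : ℤ) (l : List ℤ),
    d = Ct Q ^ c * Wt x y ^ m * (l.map (eZ (Xt x) (Wt x y))).prod) → (∃ (c m : ℤ) (l : List ℤ),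
    d * (Wt x y)⁻¹ = Ct Q ^ c * Wt x y ^ m * (l.map (eZ (Xt x) (Wt x y))).prod) := by
    rintro d ⟨c, m, l, rfl⟩
    refine ⟨c, m - 1, l.map (· - 1), ?_⟩
    rw [mul_assoc, lw', _root_.zpow_sub_one]; group
  have hτ : τt x y = Wt x y * Xt x := by rw [Wt_eq]; group
  induction hd using Subgroup.closure_induction_right with
  | one => exact ⟨0, 0, [], by simp⟩
  | mul_right a b ha hb ih =>
    rcases hb with rfl | rfl | rfl
    · exact hX _ ih
    · rw [hτ, ← mul_assoc]; exact hX _ (hW _ ih)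
    · obtain ⟨c, m, l, rfl⟩ := ih
      refine ⟨c + 1, m, l, ?_⟩
      rw [← (Ct_comm _).eq, _root_.zpow_add_one, ← (((Commute.refl (Ct Q)).zpow_right c).eq)]; group
  | mul_inv_cancel a b ha hb ih =>
    rcases hb with rfl | rfl | rfl
    · exact hX' _ ih
    · rw [hτ, _root_.mul_inv_rev, ← mul_assoc]; exact hW' _ (hX' _ ih)
    · obtain ⟨c, m, l, rfl⟩ := ih
      refine ⟨c - 1, m, l, ?_⟩
      rw [← (Ct_comm _).inv_left.eq, _root_.zpow_sub_one, ← (((Commute.refl (Ct Q)).inv_left.zpow_right c).eq)]; group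

lemma prod_U (l : List ℤ) : ∃ b, IsU (l.map (eZ xg wg)).prod (l.map (fun j => (T j : R2))).sum b := by
  induction l with
  | nil => exact ⟨0, by simpa using IsU.one⟩
  | cons a l ih =>
    obtain ⟨b, hb⟩ := ih
    obtain ⟨b', hb'⟩ := eZ_U a
    have := hb'.mul hb
    rw [List.map_cons, List.prod_cons, List.map_cons, List.sum_cons]
    exact ⟨_, this⟩

lemma w_zpow_U (m : ℤ) : ∃ u a b, IsU u a b ∧ wg ^ m = u * τg ^ m := by
  induction m using Int.induction_on with
  | zero => exact ⟨1, 0, 0, IsU.one, by simp⟩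
  | succ n ih =>
    obtain ⟨u, a, b, h, e⟩ := ih
    have h1 := h.mul ((xgi_U).conj_τ (n+1))
    refine ⟨_, _, _, h1, ?_⟩
    rw [_root_.zpow_add_one, e, wg]; group
  | pred n ih =>
    obtain ⟨u, a, b, h, e⟩ := ih
    have h1 := h.mul ((xg_U).conj_τ (-n))
    refine ⟨_, _, _, h1, ?_⟩
    rw [_root_.zpow_sub_one, e, wg]; group

lemma prod_snd (l : List ℤ) : ((l.map (eZ (Xt x) (Wt x y))).prod).2 = (l.map (eZ xg wg)).prod := by
  induction l with
  | nil => rfl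
  | cons a l ih => rw [List.map_cons, List.prod_cons, List.map_cons, List.prod_cons, ← ih]; rfl

/-- matrix form of elements: u τ^m C^k -/
lemma PP_form (hq : QH x y t) {d : Q × GL3} (hd : d ∈ PP x y) : ∃ (k m : ℤ) (u : Q × GL3) (a b : R2),
    u ∈ PP x y ∧ IsU u.2 a b ∧ d = u * τt x y ^ m * Ct Q ^ k := by
  obtain ⟨c, m, l, e⟩ := PP_nf hq hd
  obtain ⟨b, hb⟩ := prod_U l
  obtain ⟨u, a', b', hu, e'⟩ := w_zpow_U m
  have hτ : τt x y ∈ PP x y := Subgroup.subset_closure (by simp)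
  have hC : Ct Q ∈ PP x y := Subgroup.subset_closure (by simp)
  refine ⟨c, m, d * (Ct Q ^ c)⁻¹ * (τt x y ^ m)⁻¹, a' + T (-m) * (l.map (fun j => (T j : R2))).sum,
    b' + b + (1+tt) * bar a' * (T (-m) * (l.map (fun j => (T j : R2))).sum), ?_, ?_, by group⟩
  · exact mul_mem (mul_mem hd (inv_mem (zpow_mem hC c))) (inv_mem (zpow_mem hτ m))
  have h1 := hu.mul (hb.conj_τ m)
  have h2 : (d * (Ct Q ^ c)⁻¹ * (τt x y ^ m)⁻¹).2 = u * (τg ^ m * (l.map (eZ xg wg)).prod * τg ^ (-m)) := by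
    have hc : Commute (Ct Q ^ c) (Wt x y ^ m * (l.map (eZ (Xt x) (Wt x y))).prod) := (Ct_comm _).zpow_left c
    have h3 : d * (Ct Q ^ c)⁻¹ = Wt x y ^ m * (l.map (eZ (Xt x) (Wt x y))).prod := by
      rw [e, mul_assoc (Ct Q ^ c), hc.eq]; group
    have h4 := prod_snd (x := x) (y := y) l
    rw [h3]
    change wg ^ m * _ * (τg ^ m)⁻¹ = _
    rw [e', h4]; group
  rw [h2]; exact h1

end pair


section HPsec
variable {Q : Type*} [Group Q] {x y t : Q}

lemma coeff_T (i j : ℤ) : (T i : R2).coeff j = if i = j then 1 else 0 := by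
  rw [LaurentPolynomial.T_apply]

lemma T_eq_one {k : ℤ} (h : (T k : R2) = 1) : k = 0 := by
  have := congrArg (fun f : R2 => f.coeff 0) h
  simp only [← T_zero, coeff_T] at this
  by_contra hk
  simp [hk] at this

lemma coeff_add' (f g : R2) (k : ℤ) : (f + g).coeff k = f.coeff k + g.coeff k := by
  simp
lemma coeff_zero' (k : ℤ) : (0 : R2).coeff k = 0 := by simp

lemma sumT_coeff (l : List ℤ) (j : ℤ) : ((l.map (fun i => (T i : R2))).sum).coeff j = (l.count j : ZMod 2) := by
  induction l with
  | nil => simp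
  | cons a l ih =>
    rw [List.map_cons, List.sum_cons, coeff_add', ih, coeff_T, List.count_cons]
    by_cases h : a = j <;> simp [h, add_comm]

lemma even_of_cast {n : ℕ} (h : (n : ZMod 2) = 0) : Even n := (ZMod.natCast_eq_zero_iff_even).mp h

def yk (x y : Q) (k : ℕ) : Q × GL3 := if k = 0 then (Xt x) ^ 2 else bN (Xt x) (Wt x y) k
def sk (k : ℕ) : R2 := if k = 0 then 1 else T k + T (-k)

lemma bN_pair (k : ℕ) : bN (Xt x) (Wt x y) k = (bN x (y*x*y) k, bN xg wg k) := rfl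

lemma yk_snd (k : ℕ) : IsU (yk x y k).2 0 ((1+tt) * sk k) := by
  unfold yk sk
  split_ifs with h
  · simpa [Xt] using xsq_U
  · rw [bN_pair]; exact bN_U k

lemma yk_fst (hq : QH x y t) (k : ℕ) : Good x (y*x*y) (yk x y k).1 := by
  unfold yk
  split_ifs with h
  · exact hq.ph.z0good
  · rw [bN_pair]; exact hq.ph.goodb k

lemma commute_pair {a b : Q × GL3} (h1 : Commute a.1 b.1) (h2 : Commute a.2 b.2) : Commute a b :=
  Prod.ext h1 h2

lemma yk_X (hq : QH x y t) (k : ℕ) : Commute (yk x y k) (Xt x) :=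
  commute_pair (yk_fst hq k).cx (U0_comm (yk_snd k) xg_U)
lemma yk_W (hq : QH x y t) (k : ℕ) : Commute (yk x y k) (Wt x y) :=
  commute_pair (yk_fst hq k).cw (U0_w (yk_snd k))
lemma yk_sq (hq : QH x y t) (k : ℕ) : yk x y k * yk x y k = 1 :=
  Prod.ext (yk_fst hq k).sq (U0_sq (yk_snd k))
lemma yk_comm (hq : QH x y t) (k j : ℕ) : Commute (yk x y k) (yk x y j) :=
  commute_pair ((yk_fst hq k).comm (yk_fst hq j).mem) (U0_comm (yk_snd k) (yk_snd j))

def ZZ (x y : Q) : Subgroup (Q × GL3) := Subgroup.closure (Set.range (yk x y))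

lemma ZZ_X (hq : QH x y t) {z : Q × GL3} (hz : z ∈ ZZ x y) : Commute z (Xt x) ∧ Commute z (Wt x y) := by
  induction hz using Subgroup.closure_induction with
  | mem u hu => obtain ⟨k, rfl⟩ := hu; exact ⟨yk_X hq k, yk_W hq k⟩
  | one => exact ⟨Commute.one_left _, Commute.one_left _⟩
  | mul a b _ _ h1 h2 => exact ⟨h1.1.mul_left h2.1, h1.2.mul_left h2.2⟩
  | inv a _ h => exact ⟨h.1.inv_left, h.2.inv_left⟩

lemma ZZ_e (hq : QH x y t) {z : Q × GL3} (hz : z ∈ ZZ x y) (j : ℤ) : Commute z (eZ (Xt x) (Wt x y) j) := by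
  obtain ⟨h1, h2⟩ := ZZ_X hq hz
  exact ((h2.zpow_right _).mul_right h1).mul_right (h2.zpow_right _)

lemma yk_mem (k : ℕ) : yk x y k ∈ ZZ x y := Subgroup.subset_closure ⟨k, rfl⟩
lemma bN_mem (k : ℕ) : bN (Xt x) (Wt x y) k ∈ ZZ x y := by
  by_cases h : k = 0
  · rw [h, bN_zero]; exact one_mem _
  · have := yk_mem (x := x) (y := y) k
    rwa [yk, if_neg h] at this

lemma e_sq (hq : QH x y t) (j : ℤ) : eZ (Xt x) (Wt x y) j * eZ (Xt x) (Wt x y) j ∈ ZZ x y := by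
  have h0 := yk_mem (x := x) (y := y) 0
  have h1 := (yk_W hq 0).zpow_right j
  have e : yk x y 0 = Xt x ^ 2 := by simp [yk]
  have : eZ (Xt x) (Wt x y) j * eZ (Xt x) (Wt x y) j = Xt x ^ 2 := by
    rw [e] at h1
    calc _ = Wt x y ^ (-j) * (Xt x ^ 2 * Wt x y ^ j) := by rw [eZ, pow_two]; group
      _ = _ := by rw [h1.eq]; group
  rw [this, ← e]; exact h0

lemma e_comm_le (hq : QH x y t) (i : ℤ) (k : ℕ) : (eZ (Xt x) (Wt x y) i)⁻¹ * (eZ (Xt x) (Wt x y) (i+k))⁻¹ *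
    eZ (Xt x) (Wt x y) i * eZ (Xt x) (Wt x y) (i+k) ∈ ZZ x y := by
  have h0 := bN_mem (x := x) (y := y) k
  have h1 := ((ZZ_X hq h0).2.zpow_right i).eq
  have e : ∀ X W : Q × GL3, (eZ X W i)⁻¹ * (eZ X W (i+k))⁻¹ * eZ X W i * eZ X W (i+k) = W ^ (-i) * (bN X W k * W ^ i) := by
    intro X W
    have : eZ X W (i+k) = W ^ (-i) * eN X W k * W ^ i := by
      rw [← eZ_nat, eZ, eZ]; group
    rw [this, bN, eZ]; group
  rw [e, h1]
  simpa using h0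

lemma e_comm (hq : QH x y t) (i j : ℤ) : (eZ (Xt x) (Wt x y) i)⁻¹ * (eZ (Xt x) (Wt x y) j)⁻¹ *
    eZ (Xt x) (Wt x y) i * eZ (Xt x) (Wt x y) j ∈ ZZ x y := by
  rcases le_total i j with h | h
  · obtain ⟨k, rfl⟩ := Int.le.dest h
    exact e_comm_le hq i k
  · obtain ⟨k, rfl⟩ := Int.le.dest h
    have := inv_mem (e_comm_le hq j k)
    simpa [mul_assoc] using this

lemma ZZ_list (hq : QH x y t) {z : Q × GL3} (hz : z ∈ ZZ x y) : ∃ l : List ℕ, z = (l.map (yk x y)).prod := by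
  induction hz using Subgroup.closure_induction_right with
  | one => exact ⟨[], by simp⟩
  | mul_right a b ha hb ih =>
    obtain ⟨k, rfl⟩ := hb
    obtain ⟨l, rfl⟩ := ih
    exact ⟨l ++ [k], by simp⟩
  | mul_inv_cancel a b ha hb ih =>
    obtain ⟨k, rfl⟩ := hb
    obtain ⟨l, rfl⟩ := ih
    refine ⟨l ++ [k], ?_⟩
    rw [inv_eq_of_mul_eq_one_left (yk_sq hq k)]; simp

lemma yprod_U (l : List ℕ) : IsU ((l.map (yk x y)).prod).2 0 ((1+tt) * (l.map sk).sum) := by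
  induction l with
  | nil => simpa using IsU.one
  | cons a l ih =>
    rw [List.map_cons, List.prod_cons, List.map_cons, List.sum_cons]
    refine ((yk_snd a).mul ih).congr ?_ ?_
    · ring
    · rw [map_zero]; ring

lemma sk_coeff (i j : ℕ) : (sk i).coeff (j : ℤ) = if i = j then 1 else 0 := by
  unfold sk
  by_cases h : i = 0
  · subst h; rw [if_pos rfl, ← T_zero, coeff_T]; norm_cast
  · rw [if_neg h, coeff_add', coeff_T, coeff_T, if_neg (by omega : ¬ (-(i:ℤ) = j)), add_zero]; norm_cast

lemma sumsk_coeff (l : List ℕ) (j : ℕ) : ((l.map sk).sum).coeff (j : ℤ) = (l.count j : ZMod 2) := by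
  induction l with
  | nil => simp
  | cons a l ih =>
    rw [List.map_cons, List.sum_cons, coeff_add', ih, sk_coeff, List.count_cons]
    by_cases h : a = j <;> simp [h, add_comm]

lemma diag1 {R : Type*} [CommRing R] (c m A β α A' β' α' : R) :
    (!![c,0,0;0,c,0;0,0,c] * (!![1,A,β;0,1,α;0,0,1] * !![m,0,0;0,1,0;0,0,m]) * !![1,A',β';0,1,α';0,0,1]) 1 1 = c := by
  simp [Matrix.mul_apply, Fin.sum_univ_three]
lemma diag0 {R : Type*} [CommRing R] (c m A β α A' β' α' : R) :
    (!![c,0,0;0,c,0;0,0,c] * (!![1,A,β;0,1,α;0,0,1] * !![m,0,0;0,1,0;0,0,m]) * !![1,A',β';0,1,α';0,0,1]) 0 0 = c * m := by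
  simp [Matrix.mul_apply, Fin.sum_univ_three]

theorem HP (hq : QH x y t) {d : Q × GL3} (hd : d ∈ PP x y) (h1 : d.2 = 1) : d = 1 := by
  obtain ⟨c, m, l, e⟩ := PP_nf hq hd
  obtain ⟨b, hb⟩ := prod_U l
  obtain ⟨u, a', b', hu, e'⟩ := w_zpow_U m
  have h4 := prod_snd (x := x) (y := y) l
  have h2 : d.2 = scal c * wg ^ m * (l.map (eZ xg wg)).prod := by
    rw [e, ← h4, Ct_zpow]; rfl
  rw [h1, e'] at h2
  have h3 := congrArg Units.val h2
  simp only [Units.val_mul, Units.val_one] at h3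
  rw [scal_val', τg_zpow, hu.val, hb.val] at h3
  rw [Dm, Dm, Um, Um] at h3
  have hc : c = 0 := by
    apply T_eq_one
    have := congrFun (congrFun h3 1) 1
    rw [diag1] at this
    exact this.symm
  have hm : m = 0 := by
    apply T_eq_one
    have := congrFun (congrFun h3 0) 0
    rw [diag0, hc, T_zero, one_mul] at this
    exact this.symm
  subst hc; subst hm
  have e1 : d = (l.map (eZ (Xt x) (Wt x y))).prod := by simpa using e
  have h5 : (l.map (eZ xg wg)).prod = 1 := by rw [← h4, ← e1, h1]
  rw [h5] at hb
  have h6 := (hb.uniq IsU.one).1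
  have hev : ∀ i, Even (l.count i) := by
    intro i; apply even_of_cast; rw [← sumT_coeff, h6]; rfl
  have hz : d ∈ ZZ x y := by
    rw [e1]
    exact list_even _ (ZZ x y) (fun z hz i => ZZ_e hq hz i) (e_sq hq) (e_comm hq) _ l le_rfl hev
  obtain ⟨l', rfl⟩ := ZZ_list hq hz
  have h7 := yprod_U (x := x) (y := y) l'
  rw [h1] at h7
  have h8 := (h7.uniq IsU.one).2
  have h9 : (l'.map sk).sum = 0 := (mul_eq_zero.mp h8).resolve_left one_add_tt_ne
  have hev' : ∀ i, Even (l'.count i) := by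
    intro i; apply even_of_cast; rw [← sumsk_coeff, h9]; rfl
  have := list_even (yk x y) ⊥ (fun z hz i => by rw [Subgroup.mem_bot.mp hz]; exact Commute.one_left _)
    (fun i => by rw [yk_sq hq]; exact one_mem _) (fun i j => by
      have := (yk_comm hq i j).eq
      rw [Subgroup.mem_bot, mul_assoc, this]; group) _ l' le_rfl hev'
  exact Subgroup.mem_bot.mp this

end HPsec


def Vge (n : ℤ) (f : R2) : Prop := ∀ k < n, f.coeff k = 0

lemma R2_coeff01 (a : ZMod 2) : a = 0 ∨ a = 1 := by revert a; decide

lemma R2_ind {P : R2 → Prop} (h0 : P 0) (hT : ∀ k, P (T k)) (ha : ∀ f g, P f → P g → P (f + g)) (f : R2) : P f := by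
  induction f using LaurentPolynomial.induction_on' with
  | add p q hp hq => exact ha _ _ hp hq
  | C_mul_T n a =>
    rcases R2_coeff01 a with rfl | rfl
    · simpa using h0
    · simpa using hT n

lemma coeff_T_mul (k : ℤ) (f : R2) (j : ℤ) : (T k * f).coeff j = f.coeff (j - k) := by
  induction f using R2_ind with
  | h0 => simp
  | hT i =>
    rw [← T_add, coeff_T, coeff_T]
    by_cases h : k + i = j
    · rw [if_pos h, if_pos (by omega)]
    · rw [if_neg h, if_neg (by omega)]
  | ha f g hf hg => rw [mul_add, coeff_add', coeff_add', hf, hg]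

lemma Vge.add {n : ℤ} {f g : R2} (hf : Vge n f) (hg : Vge n g) : Vge n (f + g) := fun k hk => by
  rw [coeff_add', hf k hk, hg k hk, add_zero]
lemma Vge.zero (n : ℤ) : Vge n 0 := fun k hk => coeff_zero' k
lemma Vge.mono {m n : ℤ} (h : m ≤ n) {f : R2} (hf : Vge n f) : Vge m f := fun k hk => hf k (by omega)
lemma Vge.Tk (k : ℤ) : Vge k (T k) := fun j hj => by rw [coeff_T, if_neg (by omega)]
lemma Vge.Tle {k n : ℤ} (h : n ≤ k) : Vge n (T k) := (Vge.Tk k).mono h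
lemma Vge.le_of_T {k n : ℤ} (h : Vge n (T k)) : n ≤ k := by
  by_contra hc
  have := h k (by omega)
  rw [coeff_T, if_pos rfl] at this
  exact one_ne_zero this
lemma Vge.Tmul {n : ℤ} {f : R2} (k : ℤ) (hf : Vge n f) : Vge (k + n) (T k * f) := fun j hj => by
  rw [coeff_T_mul]; exact hf _ (by omega)
lemma Vge.Tmul_iff {n k : ℤ} {f : R2} : Vge n (T k * f) ↔ Vge (n - k) f := by
  constructor
  · intro h j hj
    have := h (j + k) (by omega)
    rwa [coeff_T_mul, add_sub_cancel_right] at this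
  · intro h; exact (h.Tmul k).mono (by omega)

lemma coeff_sum' {ι : Type*} (s : Finset ι) (F : ι → R2) (k : ℤ) : (∑ i ∈ s, F i).coeff k = ∑ i ∈ s, (F i).coeff k := by
  classical
  induction s using Finset.induction_on with
  | empty => simp
  | insert a s ha ih => rw [Finset.sum_insert ha, Finset.sum_insert ha, coeff_add', ih]

lemma R2_sum (f : R2) : f = ∑ k ∈ f.coeff.support, T k := by
  apply LaurentPolynomial.ext
  intro j
  rw [coeff_sum']
  simp only [coeff_T]
  rw [Finset.sum_ite_eq']
  split_ifs with h
  · rcases R2_coeff01 (f.coeff j) with h' | h'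
    · exact absurd h' (Finsupp.mem_support_iff.mp h)
    · exact h'
  · exact Finsupp.notMem_support_iff.mp h

lemma Vge.sum {ι : Type*} {n : ℤ} (s : Finset ι) (F : ι → R2) (h : ∀ i ∈ s, Vge n (F i)) : Vge n (∑ i ∈ s, F i) :=
  fun k hk => by rw [coeff_sum']; exact Finset.sum_eq_zero fun i hi => h i hi k hk

lemma Vge.mul {m n : ℤ} {f g : R2} (hf : Vge m f) (hg : Vge n g) : Vge (m + n) (f * g) := by
  rw [R2_sum f, Finset.sum_mul]
  apply Vge.sum
  intro k hk
  have : m ≤ k := by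
    by_contra hc
    exact (Finsupp.mem_support_iff.mp hk) (hf k (by omega))
  exact (hg.Tmul k).mono (by omega)

lemma Vge.mul0 {n : ℤ} {f g : R2} (hf : Vge 0 f) (hg : Vge n g) : Vge n (f * g) := (hf.mul hg).mono (by omega)

lemma Vge.pow {f : R2} (hf : Vge 1 f) (N : ℕ) : Vge N (f ^ N) := by
  induction N with
  | zero => rw [pow_zero, ← T_zero]; exact Vge.Tk 0
  | succ N ih => rw [pow_succ]; exact (ih.mul hf).mono (by push_cast; omega)

lemma Vge.one : Vge 0 (1 : R2) := by rw [← T_zero]; exact Vge.Tk 0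
lemma Vge.tt' : Vge 1 tt := Vge.Tk 1

lemma exists_Vge (f : R2) : ∃ n, Vge n f := by
  induction f using R2_ind with
  | h0 => exact ⟨0, Vge.zero 0⟩
  | hT k => exact ⟨k, Vge.Tk k⟩
  | ha f g hf hg =>
    obtain ⟨m, hm⟩ := hf
    obtain ⟨n, hn⟩ := hg
    exact ⟨min m n, (hm.mono (min_le_left _ _)).add (hn.mono (min_le_right _ _))⟩

/-- exact valuation -/
def Vex (m : ℤ) (f : R2) : Prop := Vge m f ∧ f.coeff m = 1

lemma Vex_iff {m : ℤ} {f : R2} : Vex m f ↔ Vge m f ∧ ¬ Vge (m+1) f := by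
  constructor
  · rintro ⟨h, h1⟩
    exact ⟨h, fun h2 => one_ne_zero (h1.symm.trans (h2 m (by omega)))⟩
  · rintro ⟨h, h1⟩
    refine ⟨h, (R2_coeff01 _).resolve_left fun h2 => h1 fun k hk => ?_⟩
    rcases eq_or_ne k m with rfl | hne
    · exact h2
    · exact h k (by omega)

lemma exists_Vex_of {n k : ℤ} {f : R2} (h : Vge n f) (hk : f.coeff k ≠ 0) : ∃ m, n ≤ m ∧ m ≤ k ∧ Vex m f := by
  obtain ⟨j, hj⟩ : ∃ j : ℕ, k - n < j := ⟨(k - n + 1).toNat, by omega⟩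
  induction j generalizing n with
  | zero => exact absurd (h k (by push_cast at hj; omega)) hk
  | succ j ih =>
    by_cases h2 : Vge (n+1) f
    · obtain ⟨m, h3, h4, h5⟩ := ih h2 (by push_cast at hj; omega)
      exact ⟨m, by omega, h4, h5⟩
    · refine ⟨n, le_rfl, ?_, Vex_iff.mpr ⟨h, h2⟩⟩
      by_contra hc
      exact hk (h k (by omega))

lemma exists_Vex {f : R2} (hf : f ≠ 0) : ∃ m, Vex m f := by
  obtain ⟨n, hn⟩ := exists_Vge f
  have : ∃ k, f.coeff k ≠ 0 := by
    by_contra hc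
    push Not at hc
    exact hf (LaurentPolynomial.ext fun k => by rw [hc, coeff_zero'])
  obtain ⟨k, hk⟩ := this
  obtain ⟨m, _, _, h⟩ := exists_Vex_of hn hk
  exact ⟨m, h⟩

lemma Vex.split {m : ℤ} {f : R2} (h : Vex m f) : Vge (m+1) (f + T m) := fun k hk => by
  rw [coeff_add', coeff_T]
  rcases eq_or_ne k m with rfl | hne
  · rw [h.2, if_pos rfl]; decide
  · rw [h.1 k (by omega), if_neg (by omega), add_zero]

lemma Vex.mul {m n : ℤ} {f g : R2} (hf : Vex m f) (hg : Vex n g) : Vex (m+n) (f * g) := by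
  refine ⟨hf.1.mul hg.1, ?_⟩
  have e : f * g = T m * g + (f + T m) * g := by linear_combination -(T m * g) * two_R2
  rw [e, coeff_add', coeff_T_mul, (hf.split.mul hg.1) (m+n) (by omega), add_sub_cancel_left, hg.2, add_zero]

lemma Vex.ne_zero {m : ℤ} {f : R2} (h : Vex m f) : f ≠ 0 := by
  rintro rfl
  have := h.2
  rw [coeff_zero'] at this
  exact zero_ne_one this

lemma unit_T {a b : R2} (h : a * b = 1) : ∃ k, a = T k := by
  have key : ∀ {a b : R2}, a * b = 1 → ∃ m, Vex m a ∧ Vex (-m) b := by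
    intro a b h
    have ha : a ≠ 0 := by rintro rfl; simp at h
    have hb : b ≠ 0 := by rintro rfl; simp at h
    obtain ⟨m, hm⟩ := exists_Vex ha
    obtain ⟨n, hn⟩ := exists_Vex hb
    have h1 := (hm.mul hn).2
    rw [h, ← T_zero, coeff_T] at h1
    have : 0 = m + n := by
      by_contra hc
      rw [if_neg hc] at h1
      exact zero_ne_one h1
    exact ⟨m, hm, by rwa [show -m = n by omega]⟩
  obtain ⟨m, h1, h2⟩ := key h
  obtain ⟨n, h3, h4⟩ := key (a := bar a) (b := bar b) (by rw [← map_mul, h, map_one])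
  have e1 : -n ≥ m := by
    by_contra hc
    have := h1.1 (-n) (by omega)
    rw [← bar_coeff, h3.2] at this
    exact one_ne_zero this
  have e2 : n ≥ -m := by
    by_contra hc
    have := h2.1 n (by omega)
    have h5 := h4.2
    rw [bar_coeff, neg_neg] at h5
    rw [h5] at this
    exact one_ne_zero this
  refine ⟨m, LaurentPolynomial.ext fun k => ?_⟩
  rw [coeff_T]
  rcases lt_trichotomy k m with h | h | h
  · rw [h1.1 k h, if_neg (by omega)]
  · rw [h, h1.2, if_pos rfl]
  · rw [if_neg (by omega)]
    have := h3.1 (-k) (by omega)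
    rwa [bar_coeff, neg_neg] at this

/-- approximate inverse -/
lemma approx_inv {m : ℤ} {f : R2} (h : Vex m f) (N : ℤ) : ∃ P, Vge 0 P ∧ Vge N (P * f + T m) := by
  have hu := h.split.Tmul (-m)
  set u := T (-m) * (f + T m) with hu'
  have hu1 : Vge 1 u := hu.mono (by omega)
  have e1 : (T m : R2) * T (-m) = 1 := by rw [← T_add, add_neg_cancel, T_zero]
  have hf : f = T m * (1 + u) := by
    rw [hu']; linear_combination -(f + T m) * e1 - T m * two_R2
  have hg : ∀ n : ℕ, ∃ P, Vge 0 P ∧ P * (1 + u) = 1 + u ^ n := by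
    intro n
    induction n with
    | zero => exact ⟨0, Vge.zero 0, by rw [pow_zero, zero_mul, addself]⟩
    | succ n ih =>
      obtain ⟨P, hP, e⟩ := ih
      refine ⟨P + u ^ n, hP.add ((hu1.pow n).mono (by omega)), ?_⟩
      linear_combination e + u ^ n * two_R2
  obtain ⟨P, hP, e⟩ := hg (N - m).toNat
  refine ⟨P, hP, ?_⟩
  have : P * f + T m = T m * u ^ (N - m).toNat := by
    rw [hf]; linear_combination T m * e + T m * two_R2
  rw [this]
  exact ((hu1.pow _).Tmul m).mono (by omega)

lemma div_one_add (f : R2) (N : ℤ) : ∃ g, Vge N ((1 + tt) * g + f) := by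
  obtain ⟨n, hn⟩ := exists_Vge f
  have h1 : Vex 0 (1 + tt) := by
    refine ⟨Vge.one.add (Vge.tt'.mono (by omega)), ?_⟩
    rw [coeff_add', ← T_zero, tt, coeff_T, coeff_T]; simp
  obtain ⟨P, hP, h⟩ := approx_inv h1 (N - n)
  refine ⟨P * f, ?_⟩
  have e : (1 + tt) * (P * f) + f = (P * (1 + tt) + T 0) * f := by rw [T_zero]; ring
  rw [e]
  exact (h.mul hn).mono (by omega)

lemma trunc_lem (f : R2) (n : ℤ) : ∃ g, Vge n (g + f) ∧ Vge (1 - n) (bar g) := by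
  induction f using R2_ind with
  | h0 => exact ⟨0, by simpa using Vge.zero n, by simpa using Vge.zero _⟩
  | hT k =>
    by_cases h : k < n
    · exact ⟨T k, by rw [addself]; exact Vge.zero _, by rw [bar_T]; exact Vge.Tle (by omega)⟩
    · exact ⟨0, by rw [zero_add]; exact Vge.Tle (by omega), by simpa using Vge.zero _⟩
  | ha f g hf hg =>
    obtain ⟨a, ha, ha'⟩ := hf
    obtain ⟨b, hb, hb'⟩ := hg
    refine ⟨a + b, ?_, by rw [map_add]; exact ha'.add hb'⟩
    rw [show a + b + (f + g) = (a + f) + (b + g) by ring]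
    exact ha.add hb

lemma trunc_two (q g : R2) (n : ℤ) : ∃ α, Vge n (α + q) ∧ Vge (1 - n) (bar α + g) := by
  obtain ⟨a, ha, ha'⟩ := trunc_lem q n
  obtain ⟨b, hb, hb'⟩ := trunc_lem g (1 - n)
  refine ⟨a + bar b, ?_, ?_⟩
  · rw [show a + bar b + q = (a + q) + bar b by ring]
    exact ha.add (hb'.mono (by omega))
  · rw [map_add, bar_bar, add_assoc]; exact ha'.add hb


abbrev V3 : Type := Fin 3 → R2
abbrev Lt : Type := AddSubgroup V3

structure IsLat (M : Lt) : Prop where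
  smul : ∀ f, Vge 0 f → ∀ z ∈ M, f • z ∈ M
  big : ∃ K : ℤ, ∀ z : V3, (∀ i, Vge K (z i)) → z ∈ M
  small : ∃ K : ℤ, ∀ z ∈ M, ∀ i, Vge K (z i)

lemma vaddself (z : V3) : z + z = 0 := funext fun i => addself (z i)

lemma IsLat.Tsmul {M : Lt} (h : IsLat M) {k : ℤ} (hk : 0 ≤ k) {z : V3} (hz : z ∈ M) : (T k : R2) • z ∈ M :=
  h.smul _ (Vge.Tle hk) z hz

def act (g : GL3) (M : Lt) : Lt := M.comap ((g⁻¹).val.mulVecLin.toAddMonoidHom)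

lemma mem_act {g : GL3} {M : Lt} {z : V3} : z ∈ act g M ↔ (g⁻¹).val *ᵥ z ∈ M := Iff.rfl

lemma inv_mulVec (g : GL3) (z : V3) : (g⁻¹).val *ᵥ (g.val *ᵥ z) = z := by
  rw [Matrix.mulVec_mulVec, Units.inv_mul, Matrix.one_mulVec]
lemma mulVec_inv (g : GL3) (z : V3) : g.val *ᵥ ((g⁻¹).val *ᵥ z) = z := by
  rw [Matrix.mulVec_mulVec, Units.mul_inv, Matrix.one_mulVec]

lemma act_one (M : Lt) : act 1 M = M := by
  ext z; rw [mem_act, inv_one, Units.val_one, Matrix.one_mulVec]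
lemma act_mul (g h : GL3) (M : Lt) : act (g * h) M = act g (act h M) := by
  ext z; rw [mem_act, mem_act, mem_act, _root_.mul_inv_rev, Units.val_mul, Matrix.mulVec_mulVec]
lemma mulVec_mem_act {g : GL3} {M : Lt} {z : V3} : g.val *ᵥ z ∈ act g M ↔ z ∈ M := by
  rw [mem_act, inv_mulVec]

lemma entry_bound (A : M3) : ∃ K : ℤ, ∀ i j, Vge K (A i j) := by
  have : ∀ s : Finset (Fin 3 × Fin 3), ∃ K : ℤ, ∀ p ∈ s, Vge K (A p.1 p.2) := by
    intro s
    induction s using Finset.induction_on with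
    | empty => exact ⟨0, by simp⟩
    | insert a s ha ih =>
      obtain ⟨K, hK⟩ := ih
      obtain ⟨n, hn⟩ := exists_Vge (A a.1 a.2)
      refine ⟨min K n, fun p hp => ?_⟩
      rcases Finset.mem_insert.mp hp with rfl | hp
      · exact hn.mono (min_le_right _ _)
      · exact (hK p hp).mono (min_le_left _ _)
  obtain ⟨K, hK⟩ := this Finset.univ
  exact ⟨K, fun i j => hK (i, j) (Finset.mem_univ _)⟩

lemma mulVec_bound {A : M3} {K n : ℤ} (hA : ∀ i j, Vge K (A i j)) {z : V3} (hz : ∀ i, Vge n (z i)) (i : Fin 3) :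
    Vge (K + n) ((A *ᵥ z) i) := by
  rw [Matrix.mulVec, dotProduct]
  exact Vge.sum _ _ fun j _ => (hA i j).mul (hz j)

lemma IsLat.act {M : Lt} (h : IsLat M) (g : GL3) : IsLat (act g M) := by
  refine ⟨?_, ?_, ?_⟩
  · intro f hf z hz
    rw [mem_act] at *
    rw [Matrix.mulVec_smul]; exact h.smul f hf _ hz
  · obtain ⟨K, hK⟩ := h.big
    obtain ⟨n, hn⟩ := entry_bound (g⁻¹).val
    refine ⟨K - n, fun z hz => hK _ fun i => ?_⟩
    exact (mulVec_bound hn hz i).mono (by omega)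
  · obtain ⟨K, hK⟩ := h.small
    obtain ⟨n, hn⟩ := entry_bound g.val
    refine ⟨n + K, fun z hz i => ?_⟩
    have := mulVec_bound hn (hK _ (mem_act.mp hz)) i
    rwa [mulVec_inv] at this

def near (M M' : Lt) : Prop := ∃ k : ℤ, (∀ z ∈ M', (T k : R2) • z ∈ M) ∧ (∀ z ∈ M, (T (1 - k) : R2) • z ∈ M')

lemma near.symm {M M' : Lt} (h : near M M') : near M' M := by
  obtain ⟨k, h1, h2⟩ := h
  exact ⟨1 - k, h2, by simpa using h1⟩

lemma near.act {M M' : Lt} (h : near M M') (g : GL3) : near (act g M) (act g M') := by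
  obtain ⟨k, h1, h2⟩ := h
  refine ⟨k, fun z hz => ?_, fun z hz => ?_⟩
  · rw [mem_act, Matrix.mulVec_smul]; exact h1 _ hz
  · rw [mem_act, Matrix.mulVec_smul]; exact h2 _ hz

lemma near_refl {M : Lt} (h : IsLat M) : near M M :=
  ⟨0, fun z hz => h.Tsmul le_rfl hz, fun z hz => h.Tsmul (by omega) hz⟩

def e1 : V3 := ![1, 0, 0]

def HLe (M : Lt) (h : ℤ) : Prop := ∃ a : ℤ, (T a : R2) • e1 ∈ M ∧ ∀ z ∈ M, Vge (a - h) (z 2)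

lemma HLe.mono {M : Lt} {m n : ℤ} (hmn : m ≤ n) (h : HLe M m) : HLe M n := by
  obtain ⟨a, h1, h2⟩ := h
  exact ⟨a, h1, fun z hz => (h2 z hz).mono (by omega)⟩

/-- scaling -/
def sc (k : ℤ) (M : Lt) : Lt := act (scal k) M

lemma scal_inv_val (k : ℤ) : ((scal k)⁻¹).val = Matrix.scalar (Fin 3) (T (-k)) := by
  have : (scal k)⁻¹ = scal (-k) := by rw [inv_eq_iff_mul_eq_one, ← scal_add, add_neg_cancel, scal_zero]
  rw [this, scal_val]

lemma scalar_mulVec (f : R2) (z : V3) : Matrix.scalar (Fin 3) f *ᵥ z = f • z := by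
  rw [Matrix.scalar_apply, ← Matrix.smul_one_eq_diagonal, Matrix.smul_mulVec, Matrix.one_mulVec]

lemma mem_sc {k : ℤ} {M : Lt} {z : V3} : z ∈ sc k M ↔ (T (-k) : R2) • z ∈ M := by
  rw [sc, mem_act, scal_inv_val, scalar_mulVec]

lemma T_smul_smul (a b : ℤ) (z : V3) : (T a : R2) • (T b : R2) • z = (T (a + b) : R2) • z := by
  rw [smul_smul, ← T_add]
lemma T_zero_smul (z : V3) : (T 0 : R2) • z = z := by rw [T_zero, one_smul]
lemma T_smul_smul_eq {a b c : ℤ} (h : a + b = c) (z : V3) : (T a : R2) • (T b : R2) • z = (T c : R2) • z := by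
  rw [smul_smul, ← T_add, h]

lemma T_smul_mem_sc {k j : ℤ} {M : Lt} {z : V3} : (T j : R2) • z ∈ sc k M ↔ (T (j - k) : R2) • z ∈ M := by
  rw [mem_sc, T_smul_smul_eq (show -k + j = j - k by ring)]

lemma near_sc {M M' : Lt} (k : ℤ) : near M (sc k M') ↔ near M M' := by
  constructor
  · rintro ⟨j, h1, h2⟩
    refine ⟨j + k, fun z hz => ?_, fun z hz => ?_⟩
    · have := h1 ((T k : R2) • z) (by rw [T_smul_mem_sc, sub_self, T_zero_smul]; exact hz)
      rwa [T_smul_smul] at this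
    · have := h2 z hz
      rw [T_smul_mem_sc] at this
      rwa [show 1 - (j + k) = 1 - j - k by ring]
  · rintro ⟨j, h1, h2⟩
    refine ⟨j - k, fun z hz => ?_, fun z hz => ?_⟩
    · have := h1 _ (mem_sc.mp hz)
      rwa [T_smul_smul_eq (show j + -k = j - k by ring)] at this
    · rw [T_smul_mem_sc]
      have := h2 z hz
      rwa [show 1 - (j - k) - k = 1 - j by ring]

lemma near_sc' {M M' : Lt} (k : ℤ) : near (sc k M) M' ↔ near M M' :=
  ⟨fun h => ((near_sc k).mp h.symm).symm, fun h => ((near_sc k).mpr h.symm).symm⟩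

lemma smul_two (f : R2) (z : V3) (i : Fin 3) : (f • z) i = f * z i := rfl

lemma HLe_sc {M : Lt} {h : ℤ} (k : ℤ) : HLe (sc k M) h ↔ HLe M h := by
  constructor
  · rintro ⟨a, h1, h2⟩
    refine ⟨a - k, T_smul_mem_sc.mp h1, fun z hz => ?_⟩
    have := h2 ((T k : R2) • z) (by rw [T_smul_mem_sc, sub_self, T_zero_smul]; exact hz)
    rw [smul_two, Vge.Tmul_iff] at this
    exact this.mono (by omega)
  · rintro ⟨a, h1, h2⟩
    refine ⟨a + k, by rw [T_smul_mem_sc, add_sub_cancel_right]; exact h1, fun z hz => ?_⟩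
    have := h2 _ (mem_sc.mp hz)
    rw [smul_two, Vge.Tmul_iff] at this
    exact this.mono (by omega)

lemma IsLat.sc {M : Lt} (h : IsLat M) (k : ℤ) : IsLat (sc k M) := h.act _

/-- sandwich -/
def sand (M N : Lt) : Prop := (∀ z ∈ N, z ∈ M) ∧ (∀ z ∈ M, (T 1 : R2) • z ∈ N)

lemma near.sand {M N : Lt} (h : near M N) : ∃ k, sand M (sc k N) := by
  obtain ⟨k, h1, h2⟩ := h
  refine ⟨k, fun z hz => ?_, fun z hz => ?_⟩
  · have := h1 _ (mem_sc.mp hz)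
    rwa [T_smul_smul_eq (show k + -k = 0 by ring), T_zero_smul] at this
  · rw [T_smul_mem_sc]; exact h2 z hz

lemma sand.near {M N : Lt} (h : sand M N) : near M N :=
  ⟨0, fun z hz => by rw [T_zero_smul]; exact h.1 z hz, fun z hz => by rw [sub_zero]; exact h.2 z hz⟩

lemma near.HLe {M N : Lt} (h : near M N) {n : ℤ} (hM : HLe M n) : HLe N (n+1) := by
  obtain ⟨k, h1, h2⟩ := h
  obtain ⟨a, h3, h4⟩ := hM
  refine ⟨a + (1 - k), ?_, fun z hz => ?_⟩
  · have := h2 _ h3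
    rwa [T_smul_smul_eq (show 1 - k + a = a + (1 - k) by ring)] at this
  · have := h4 _ (h1 z hz)
    rw [smul_two, Vge.Tmul_iff] at this
    exact this.mono (by omega)

/-- Lemma E -/
lemma lemE {A : Lt} (hs : ∀ f, Vge 0 f → ∀ z ∈ A, f • z ∈ A) {i : Fin 3} {K : ℤ}
    (hb : ∀ f, Vge K f → Pi.single i f ∈ A) {y : V3} (hy : y ∈ A) {m : ℤ} (hm : Vex m (y i)) :
    ∃ y' ∈ A, y' i = T m := by
  obtain ⟨P, hP, h⟩ := approx_inv hm K
  refine ⟨P • y + Pi.single i (P * y i + T m), add_mem (hs P hP y hy) (hb _ h), ?_⟩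
  rw [Pi.add_apply, Pi.single_eq_same, smul_two, ← add_assoc, addself, zero_add]

lemma lemD {A : Lt} (hs : ∀ f, Vge 0 f → ∀ z ∈ A, f • z ∈ A) {i : Fin 3} {K : ℤ}
    (hb : ∀ f, Vge K f → Pi.single i f ∈ A) {y : V3} (hy : y ∈ A) {m : ℤ} (hm : Vex m (y i))
    {z : V3} (hz : Vge (m+1) (z i)) : ∃ w ∈ A, (z + (T 1 : R2) • w) i = 0 := by
  obtain ⟨y', hy', e⟩ := lemE hs hb hy hm
  have h1 : Vge 0 (T (-m-1) * z i) := (hz.Tmul _).mono (by omega)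
  refine ⟨(T (-m-1) * z i) • y', hs _ h1 _ hy', ?_⟩
  rw [Pi.add_apply, smul_two, smul_two, e]
  have e2 : (T 1 : R2) * (T (-m-1) * z i * T m) = z i := by
    rw [show (T 1 : R2) * (T (-m-1) * z i * T m) = T 1 * T (-m-1) * T m * z i by ring, ← T_add, ← T_add,
      show 1 + (-m-1) + m = (0:ℤ) by ring, T_zero, one_mul]
  rw [e2, addself]

lemma IsLat.single {M : Lt} (h : IsLat M) : ∃ K : ℤ, ∀ i f, Vge K f → Pi.single i f ∈ M := by
  obtain ⟨K, hK⟩ := h.big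
  refine ⟨K, fun i f hf => hK _ fun j => ?_⟩
  rcases eq_or_ne j i with rfl | hne
  · rw [Pi.single_eq_same]; exact hf
  · rw [Pi.single_eq_of_ne hne]; exact Vge.zero _

lemma e1_form {z : V3} (h1 : z 1 = 0) (h2 : z 2 = 0) (a : ℤ) : z = (T (-a) * z 0) • (T a : R2) • e1 := by
  have e : (T (-a) : R2) * z 0 * T a = z 0 := by
    rw [mul_right_comm, ← T_add, neg_add_cancel, T_zero, one_mul]
  funext i
  fin_cases i
  · simp [e1, e]
  · simp [e1, h1]
  · simp [e1, h2]

/-- elements of M on the e1-line -/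
lemma e1_line {M : Lt} (hM : IsLat M) {n a : ℤ} (h1 : ∀ z ∈ M, Vge (a - (n+1)) (z 2)) (h2 : ¬ HLe M n)
   {z : V3} (hz : z ∈ M) (hz1 : z 1 = 0) (hz2 : z 2 = 0) : Vge a (z 0) := by
  by_contra hc
  have : ∃ k < a, (z 0).coeff k ≠ 0 := by
    by_contra hc2; push Not at hc2; exact hc hc2
  obtain ⟨k, hk, hk2⟩ := this
  obtain ⟨n0, hn0⟩ := exists_Vge (z 0)
  obtain ⟨m, _, hm1, hm⟩ := exists_Vex_of hn0 hk2
  obtain ⟨K, hK⟩ := hM.single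
  obtain ⟨P, hP, h⟩ := approx_inv hm K
  apply h2
  refine ⟨a - 1, ?_, fun z hz => (h1 z hz).mono (by omega)⟩
  have h3 : (T m : R2) • e1 ∈ M := by
    have := add_mem (hM.smul P hP z hz) (hK 0 _ h)
    convert this using 1
    funext i
    fin_cases i
    · simp [e1]; rw [← add_assoc, addself, zero_add]
    · simp [e1, hz1]
    · simp [e1, hz2]
  have := hM.Tsmul (show 0 ≤ a - 1 - m by omega) h3
  rwa [T_smul_smul_eq (show a - 1 - m + m = a - 1 by ring)] at this


/-- M intersected with third coordinate bound -/
def cut (M : Lt) (m : ℤ) : Lt where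
  carrier := {z | z ∈ M ∧ Vge m (z 2)}
  add_mem' := fun h h' => ⟨add_mem h.1 h'.1, h.2.add h'.2⟩
  zero_mem' := ⟨zero_mem _, Vge.zero _⟩
  neg_mem' := fun {z} h => ⟨neg_mem h.1, by
    have : (-z) = z := by rw [neg_eq_iff_add_eq_zero, vaddself]
    rw [this]; exact h.2⟩

lemma mem_cut {M : Lt} {m : ℤ} {z : V3} : z ∈ cut M m ↔ z ∈ M ∧ Vge m (z 2) := Iff.rfl

lemma IsLat.cut {M : Lt} (h : IsLat M) (m : ℤ) : IsLat (cut M m) := by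
  refine ⟨fun f hf z hz => ⟨h.smul f hf z hz.1, hf.mul0 hz.2⟩, ?_, ?_⟩
  · obtain ⟨K, hK⟩ := h.big
    exact ⟨max K m, fun z hz => ⟨hK z fun i => (hz i).mono (le_max_left _ _), (hz 2).mono (le_max_right _ _)⟩⟩
  · obtain ⟨K, hK⟩ := h.small
    exact ⟨K, fun z hz => hK z hz.1⟩

lemma e1_2 (a : ℤ) : ((T a : R2) • e1) 2 = 0 := by simp [e1]

lemma F1a {M : Lt} (hM : IsLat M) {n : ℤ} (h1 : HLe M (n+1)) (h2 : ¬ HLe M n) :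
    ∃ N, IsLat N ∧ near M N ∧ HLe N n := by
  obtain ⟨a, h3, h4⟩ := h1
  refine ⟨cut M (a - n), hM.cut _, sand.near ⟨fun z hz => hz.1, fun z hz => ⟨hM.Tsmul (by omega) hz, ?_⟩⟩, a, ⟨h3, ?_⟩, fun z hz => hz.2⟩
  · rw [smul_two]; exact ((h4 z hz).Tmul 1).mono (by omega)
  · rw [e1_2]; exact Vge.zero _

lemma tops {M : Lt} {n a : ℤ} (h3 : (T a : R2) • e1 ∈ M) (h4 : ∀ z ∈ M, Vge (a - (n+1)) (z 2)) (h2 : ¬ HLe M n) :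
    ∃ y ∈ M, Vex (a - (n+1)) (y 2) := by
  by_contra hc
  push Not at hc
  refine h2 ⟨a, h3, fun z hz => ?_⟩
  by_contra hv
  refine hc z hz (Vex_iff.mpr ⟨h4 z hz, fun h => hv (h.mono (by omega))⟩)

lemma HLe_sand {M N : Lt} (hM : IsLat M) {n a : ℤ} (h3 : (T a : R2) • e1 ∈ M) (h4 : ∀ z ∈ M, Vge (a - (n+1)) (z 2)) (h2 : ¬ HLe M n)
    (hs : sand M N) (hN : HLe N n) : (T a : R2) • e1 ∈ N ∧ ∀ z ∈ N, Vge (a - n) (z 2) := by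
  obtain ⟨a', h5, h6⟩ := hN
  have e1' : a ≤ a' := by
    by_contra hc
    refine h2 ⟨a - 1, ?_, fun z hz => (h4 z hz).mono (by omega)⟩
    have := hM.Tsmul (show 0 ≤ a - 1 - a' by omega) (hs.1 _ h5)
    rwa [T_smul_smul_eq (show a - 1 - a' + a' = a - 1 by ring)] at this
  have e2' : a' ≤ a := by
    by_contra hc
    refine h2 ⟨a, h3, fun z hz => ?_⟩
    have := h6 _ (hs.2 z hz)
    rw [smul_two, Vge.Tmul_iff] at this
    exact this.mono (by omega)
  have : a' = a := by omega
  subst this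
  exact ⟨h5, h6⟩

def zero2 (M : Lt) : Lt where
  carrier := {z | z ∈ M ∧ z 2 = 0}
  add_mem' := fun h h' => ⟨add_mem h.1 h'.1, by rw [Pi.add_apply, h.2, h'.2, add_zero]⟩
  zero_mem' := ⟨zero_mem _, rfl⟩
  neg_mem' := fun h => ⟨neg_mem h.1, by rw [Pi.neg_apply, h.2, neg_zero]⟩

lemma zero2_smul {M : Lt} (hM : IsLat M) : ∀ f, Vge 0 f → ∀ z ∈ zero2 M, f • z ∈ zero2 M :=
  fun f hf z hz => ⟨hM.smul f hf z hz.1, by rw [smul_two, hz.2, mul_zero]⟩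
lemma zero2_big {M : Lt} (hM : IsLat M) : ∃ K : ℤ, ∀ f, Vge K f → Pi.single 1 f ∈ zero2 M := by
  obtain ⟨K, hK⟩ := hM.single
  exact ⟨K, fun f hf => ⟨hK 1 f hf, by simp⟩⟩

/-- key comparison -/
lemma F1b_key {M N N' : Lt} (hM : IsLat M) (hN' : IsLat N') {n a : ℤ} 
    (h4 : ∀ z ∈ M, Vge (a - (n+1)) (z 2)) (h2 : ¬ HLe M n)
    (hs : sand M N) (hs' : sand M N') (hN'1 : (T a : R2) • e1 ∈ N')
    {z z' : V3} (hz : z ∈ N) (hz' : z' ∈ N') (hz2 : z 2 = 0) (hz'2 : z' 2 = 0)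
    {m : ℤ} (hm' : Vex m (z' 1)) (hm : Vge m (z 1)) : z ∈ N' := by
  have line : ∀ u ∈ M, u 1 = 0 → u 2 = 0 → u ∈ N' := by
    intro u hu h1 h2'
    rw [e1_form h1 h2' a]
    refine hN'.smul _ ?_ _ hN'1
    exact ((e1_line hM h4 h2 hu h1 h2').Tmul (-a)).mono (by omega)
  obtain ⟨K, hK⟩ := zero2_big hM
  have red : ∀ u ∈ M, u 2 = 0 → Vge (m+1) (u 1) → u ∈ N' := by
    intro u hu hu2 hu1
    obtain ⟨w, hw, e⟩ := lemD (zero2_smul hM) hK (y := z') ⟨hs'.1 _ hz', hz'2⟩ hm' hu1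
    have h5 := line (u + (T 1 : R2) • w) (add_mem hu (hM.Tsmul (by omega) hw.1)) e
      (by rw [Pi.add_apply, smul_two, hu2, hw.2, mul_zero, add_zero])
    have h6 := add_mem h5 (hs'.2 w hw.1)
    rwa [add_assoc, vaddself, add_zero] at h6
  by_cases h : Vge (m+1) (z 1)
  · exact red z (hs.1 _ hz) hz2 h
  · have hx : Vex m (z 1) := Vex_iff.mpr ⟨hm, h⟩
    have h7 := red (z + z') (add_mem (hs.1 _ hz) (hs'.1 _ hz')) (by rw [Pi.add_apply, hz2, hz'2, add_zero]) (by
      have := hx.split.add hm'.split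
      rw [Pi.add_apply]
      rwa [show z 1 + T m + (z' 1 + T m) = z 1 + z' 1 + (T m + T m) by ring, addself, add_zero] at this)
    have h8 := add_mem h7 hz'
    rwa [add_assoc, vaddself, add_zero] at h8

lemma F1b {M N N' : Lt} (hM : IsLat M) (hN : IsLat N) (hN' : IsLat N') {n : ℤ} (h1 : HLe M (n+1)) (h2 : ¬ HLe M n)
    (hn : near M N) (hn' : near M N') (hHN : HLe N n) (hHN' : HLe N' n) : near N N' := by
  obtain ⟨k, hs⟩ := hn.sand
  obtain ⟨k', hs'⟩ := hn'.sand
  rw [← near_sc k', ← near_sc' k]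
  replace hHN := (HLe_sc k).mpr hHN
  replace hHN' := (HLe_sc k').mpr hHN'
  replace hN := hN.sc k
  replace hN' := hN'.sc k'
  generalize sc k N = N at *
  generalize sc k' N' = N' at *
  obtain ⟨a, h3, h4⟩ := h1
  obtain ⟨b1, b2⟩ := HLe_sand hM h3 h4 h2 hs hHN
  obtain ⟨b1', b2'⟩ := HLe_sand hM h3 h4 h2 hs' hHN'
  by_cases c1 : ∀ z ∈ N, z ∈ N'
  · exact (sand.near ⟨c1, fun z hz => hs.2 z (hs'.1 z hz)⟩).symm
  by_cases c2 : ∀ z ∈ N', z ∈ N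
  · exact sand.near ⟨c2, fun z hz => hs'.2 z (hs.1 z hz)⟩
  exfalso
  push Not at c1 c2
  obtain ⟨z, hz, hzn⟩ := c1
  obtain ⟨z', hz', hzn'⟩ := c2
  obtain ⟨y, hy, hyv⟩ := tops h3 h4 h2
  obtain ⟨K, hK⟩ := hM.single
  obtain ⟨w, hw, e⟩ := lemD hM.smul (hK 2) hy hyv (z := z) ((b2 z hz).mono (by omega))
  obtain ⟨w', hw', e'⟩ := lemD hM.smul (hK 2) hy hyv (z := z') ((b2' z' hz').mono (by omega))
  have q1 : z + (T 1 : R2) • w ∈ N := add_mem hz (hs.2 w hw)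
  have q2 : z + (T 1 : R2) • w ∉ N' := fun h => hzn (by
    have := add_mem h (hs'.2 w hw)
    rwa [add_assoc, vaddself, add_zero] at this)
  have q1' : z' + (T 1 : R2) • w' ∈ N' := add_mem hz' (hs'.2 w' hw')
  have q2' : z' + (T 1 : R2) • w' ∉ N := fun h => hzn' (by
    have := add_mem h (hs.2 w' hw')
    rwa [add_assoc, vaddself, add_zero] at this)
  generalize z + (T 1 : R2) • w = u at *
  generalize z' + (T 1 : R2) • w' = u' at *
  have line : ∀ N : Lt, IsLat N → (T a : R2) • e1 ∈ N → ∀ u ∈ M, u 1 = 0 → u 2 = 0 → u ∈ N := by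
    intro N hN hN1 u hu h1 h2'
    rw [e1_form h1 h2' a]
    refine hN.smul _ ?_ _ hN1
    exact ((e1_line hM h4 h2 hu h1 h2').Tmul (-a)).mono (by omega)
  have n1 : u 1 ≠ 0 := fun h => q2 (line N' hN' b1' u (hs.1 _ q1) h e)
  have n1' : u' 1 ≠ 0 := fun h => q2' (line N hN b1 u' (hs'.1 _ q1') h e')
  obtain ⟨m, hm⟩ := exists_Vex n1
  obtain ⟨m', hm'⟩ := exists_Vex n1'
  rcases le_total m m' with h | h
  · exact q2' (F1b_key hM hN h4 h2 hs' hs b1 q1' q1 e' e hm (hm'.1.mono h))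
  · exact q2 (F1b_key hM hN' h4 h2 hs hs' b1' q1 q1' e e' hm' (hm.1.mono h))

/-- M + O·v -/
def addv (M : Lt) (v : V3) : Lt where
  carrier := {z | ∃ f, Vge 0 f ∧ z + f • v ∈ M}
  add_mem' := by
    rintro z z' ⟨f, hf, h⟩ ⟨f', hf', h'⟩
    refine ⟨f + f', hf.add hf', ?_⟩
    have := add_mem h h'
    rw [add_smul]; convert this using 1; abel
  zero_mem' := ⟨0, Vge.zero _, by simp⟩
  neg_mem' := by
    rintro z ⟨f, hf, h⟩
    refine ⟨f, hf, ?_⟩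
    have : (-z) = z := by rw [neg_eq_iff_add_eq_zero, vaddself]
    rwa [this]

lemma mem_addv {M : Lt} {v z : V3} : z ∈ addv M v ↔ ∃ f, Vge 0 f ∧ z + f • v ∈ M := Iff.rfl
lemma le_addv {M : Lt} {v z : V3} (h : z ∈ M) : z ∈ addv M v := ⟨0, Vge.zero _, by simpa using h⟩

lemma IsLat.addv {M : Lt} (hM : IsLat M) (v : V3) : IsLat (addv M v) := by
  refine ⟨?_, ?_, ?_⟩
  · rintro f hf z ⟨g, hg, h⟩
    refine ⟨f * g, hf.mul0 hg, ?_⟩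
    have := hM.smul f hf _ h
    rwa [smul_add, smul_smul] at this
  · obtain ⟨K, hK⟩ := hM.big
    exact ⟨K, fun z hz => le_addv (hK z hz)⟩
  · obtain ⟨K, hK⟩ := hM.small
    obtain ⟨n0, hn0⟩ := exists_Vge (v 0)
    obtain ⟨n1, hn1⟩ := exists_Vge (v 1)
    obtain ⟨n2, hn2⟩ := exists_Vge (v 2)
    refine ⟨min K (min n0 (min n1 n2)), ?_⟩
    rintro z ⟨f, hf, h⟩ i
    have hv : Vge (min n0 (min n1 n2)) (v i) := by
      fin_cases i
      · exact hn0.mono (by omega)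
      · exact hn1.mono (by omega)
      · exact hn2.mono (by omega)
    have h1 := ((hK _ h i).mono (min_le_left K (min n0 (min n1 n2)))).add
      ((hf.mul0 hv).mono (min_le_right K (min n0 (min n1 n2))))
    rw [Pi.add_apply, smul_two, add_assoc, addself, add_zero] at h1
    exact h1

lemma F1c {M M' : Lt} (hM : IsLat M) (hM' : IsLat M') {n : ℤ} (h1 : HLe M (n+1)) (h2 : ¬ HLe M n)
    (h1' : HLe M' (n+1)) (h2' : ¬ HLe M' n) (hn : near M M') : ∃ N, IsLat N ∧ near M N ∧ near M' N ∧ HLe N n := by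
  obtain ⟨k, hs⟩ := hn.sand
  rw [← HLe_sc k] at h1' h2'
  suffices ∃ N, IsLat N ∧ near M N ∧ near (sc k M') N ∧ HLe N n by
    obtain ⟨N, q1, q2, q3, q4⟩ := this
    exact ⟨N, q1, q2, (near_sc' k).mp q3, q4⟩
  replace hM' := hM'.sc k
  clear hn
  generalize sc k M' = M' at *
  obtain ⟨a, h3, h4⟩ := h1
  obtain ⟨a', h3', h4'⟩ := h1'
  have b1 : a ≤ a' := by
    by_contra hc
    refine h2 ⟨a - 1, ?_, fun z hz => (h4 z hz).mono (by omega)⟩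
    have := hM.Tsmul (show 0 ≤ a - 1 - a' by omega) (hs.1 _ h3')
    rwa [T_smul_smul_eq (show a - 1 - a' + a' = a - 1 by ring)] at this
  have h5 : (T (a+1) : R2) • e1 ∈ M' := by
    have := hs.2 _ h3
    rwa [T_smul_smul_eq (show 1 + a = a + 1 by ring)] at this
  have b2 : a' ≤ a + 1 := by
    by_contra hc
    refine h2' ⟨a' - 1, ?_, fun z hz => (h4' z hz).mono (by omega)⟩
    have := hM'.Tsmul (show 0 ≤ a' - 1 - (a + 1) by omega) h5
    rwa [T_smul_smul_eq (show a' - 1 - (a+1) + (a+1) = a' - 1 by ring)] at this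
  have : a' = a ∨ a' = a + 1 := by omega
  rcases this with rfl | rfl
  · refine ⟨cut M' (a' - n), hM'.cut _, sand.near ⟨fun z hz => hs.1 z hz.1, fun z hz => ⟨hs.2 z hz, ?_⟩⟩,
      sand.near ⟨fun z hz => hz.1, fun z hz => ⟨hM'.Tsmul (by omega) hz, ?_⟩⟩, a', ⟨h3', ?_⟩, fun z hz => hz.2⟩
    · rw [smul_two]; exact ((h4 z hz).Tmul 1).mono (by omega)
    · rw [smul_two]; exact ((h4' z hz).Tmul 1).mono (by omega)
    · rw [e1_2]; exact Vge.zero _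
  · refine ⟨addv M' ((T a : R2) • e1), hM'.addv _, sand.near ⟨?_, fun z hz => le_addv (hs.2 z hz)⟩,
      (sand.near ⟨fun z hz => le_addv hz, ?_⟩).symm, a, ⟨1, Vge.one, ?_⟩, ?_⟩
    · rintro z ⟨f, hf, h⟩
      have := add_mem (hs.1 _ h) (hM.smul f hf _ h3)
      rwa [add_assoc, vaddself, add_zero] at this
    · rintro z ⟨f, hf, h⟩
      have := add_mem (hM'.Tsmul (show (0:ℤ) ≤ 1 by omega) h) (hM'.smul f hf _ h5)
      convert this using 1
      rw [smul_add, smul_comm, T_smul_smul_eq (show 1 + a = a + 1 by ring), add_assoc, vaddself, add_zero]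
    · rw [one_smul, vaddself]; exact zero_mem _
    · rintro z ⟨f, hf, h⟩
      have := h4' _ h
      rw [Pi.add_apply, smul_two, e1_2, mul_zero, add_zero] at this
      exact this.mono (by omega)


def Par (g : GL3) : Prop := ∃ k : ℤ, g.val *ᵥ e1 = (T k : R2) • e1 ∧ ∀ z : V3, (g.val *ᵥ z) 2 = T k * z 2

lemma Par.one : Par 1 := ⟨0, by simp, fun z => by simp⟩
lemma Par.mul {g h : GL3} (hg : Par g) (hh : Par h) : Par (g * h) := by
  obtain ⟨k, a, b⟩ := hg
  obtain ⟨j, c, d⟩ := hh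
  refine ⟨k + j, ?_, fun z => ?_⟩
  · rw [Units.val_mul, ← Matrix.mulVec_mulVec, c, Matrix.mulVec_smul, a, T_smul_smul, add_comm]
  · rw [Units.val_mul, ← Matrix.mulVec_mulVec, b, d, ← mul_assoc, ← T_add]
lemma Par.inv {g : GL3} (hg : Par g) : Par g⁻¹ := by
  obtain ⟨k, a, b⟩ := hg
  refine ⟨-k, ?_, fun z => ?_⟩
  · have := congrArg (fun v => (T (-k) : R2) • ((g⁻¹).val *ᵥ v)) a
    simp only [Matrix.mulVec_smul, inv_mulVec] at this
    rw [T_smul_smul_eq (show -k + k = 0 by ring), T_zero_smul] at this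
    exact this.symm
  · have := b ((g⁻¹).val *ᵥ z)
    rw [mulVec_inv] at this
    rw [this, ← mul_assoc, ← T_add, neg_add_cancel, T_zero, one_mul]

lemma IsU.par {g : GL3} {a b : R2} (h : IsU g a b) : Par g := by
  refine ⟨0, ?_, fun z => ?_⟩
  · rw [h.val, T_zero_smul]
    funext i; fin_cases i <;> simp [Um, e1, Matrix.mulVec, dotProduct, Fin.sum_univ_three]
  · rw [h.val]
    simp [Um, Matrix.mulVec, dotProduct, Fin.sum_univ_three]
lemma Par_Dm {g : GL3} {k : ℤ} {b : R2} (h : g.val = Dm (T k) b (T k)) : Par g := by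
  refine ⟨k, ?_, fun z => ?_⟩
  · rw [h]
    funext i; fin_cases i <;> simp [Dm, e1, Matrix.mulVec, dotProduct, Fin.sum_univ_three]
  · rw [h]
    simp [Dm, Matrix.mulVec, dotProduct, Fin.sum_univ_three]

lemma Par.HLe' {g : GL3} (hg : Par g) {M : Lt} {h : ℤ} (hM : HLe M h) : HLe (act g M) h := by
  obtain ⟨k, a, b⟩ := hg
  obtain ⟨c, h1, h2⟩ := hM
  refine ⟨k + c, ?_, fun z hz => ?_⟩
  · have := (mulVec_mem_act (g := g)).mpr h1
    rwa [Matrix.mulVec_smul, a, T_smul_smul, add_comm] at this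
  · have := b ((g⁻¹).val *ᵥ z)
    rw [mulVec_inv] at this
    rw [this]
    exact ((h2 _ (mem_act.mp hz)).Tmul k).mono (by omega)

lemma Par.HLe_iff {g : GL3} (hg : Par g) {M : Lt} {h : ℤ} : HLe (act g M) h ↔ HLe M h := by
  refine ⟨fun H => ?_, hg.HLe'⟩
  have := hg.inv.HLe' H
  rwa [← act_mul, inv_mul_cancel, act_one] at this

def e3 : V3 := ![0, 0, 1]

lemma Jg_e1 : Jg.val *ᵥ e1 = e3 := by
  funext i; fin_cases i <;> simp [Jg, e1, e3, Matrix.mulVec, dotProduct, Fin.sum_univ_three]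
lemma Jgi_2 (z : V3) : ((Jg⁻¹).val *ᵥ z) 2 = T (-1) * z 0 := by
  have : (Jg⁻¹).val = !![0,0,1;0,1,0;ti,0,0] := rfl
  rw [this]
  simp [ti, Matrix.mulVec, dotProduct, Fin.sum_univ_three]

lemma HLe_uJ (u : GL3) (M : Lt) : HLe (act (u * Jg)⁻¹ M) 0 ↔
    ∃ c : ℤ, (T c : R2) • (u.val *ᵥ e3) ∈ M ∧ ∀ z ∈ M, Vge (c + 1) (((u⁻¹).val *ᵥ z) 0) := by
  have k1 : ∀ z : V3, z ∈ act (u * Jg)⁻¹ M ↔ u.val *ᵥ (Jg.val *ᵥ z) ∈ M := fun z => by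
    rw [mem_act, inv_inv, Units.val_mul, Matrix.mulVec_mulVec]
  constructor
  · rintro ⟨c, h1, h2⟩
    refine ⟨c, ?_, fun z hz => ?_⟩
    · rw [k1, Matrix.mulVec_smul, Matrix.mulVec_smul, Jg_e1] at h1; exact h1
    · have := h2 ((Jg⁻¹).val *ᵥ ((u⁻¹).val *ᵥ z)) (by rw [k1, mulVec_inv, mulVec_inv]; exact hz)
      rw [Jgi_2, Vge.Tmul_iff] at this
      exact this.mono (by omega)
  · rintro ⟨c, h1, h2⟩
    refine ⟨c, ?_, fun z hz => ?_⟩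
    · rw [k1, Matrix.mulVec_smul, Matrix.mulVec_smul, Jg_e1]; exact h1
    · have := h2 _ ((k1 z).mp hz)
      rw [inv_mulVec] at this
      have e := Jgi_2 (Jg.val *ᵥ z)
      rw [inv_mulVec] at e
      rw [e, Vge.Tmul_iff]; exact this.mono (by omega)

lemma IsU.e3 {g : GL3} {a b : R2} (h : IsU g a b) : g.val *ᵥ e3 = ![b, a, 1] := by
  rw [h.val]
  funext i; fin_cases i <;> simp [Um, _root_.e3, Matrix.mulVec, dotProduct, Fin.sum_univ_three]
lemma IsU.row {g : GL3} {a b : R2} (h : IsU g a b) (z : V3) :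
    (g.val *ᵥ z) 0 = z 0 + (1 + tt) * bar a * z 1 + b * z 2 := by
  rw [h.val]
  simp [Um, Matrix.mulVec, dotProduct, Fin.sum_univ_three]

section cov
variable {Q : Type*} [Group Q] {x y t : Q}

lemma X_mem : Xt x ∈ PP x y := Subgroup.subset_closure (by simp)
lemma τ_mem : τt x y ∈ PP x y := Subgroup.subset_closure (by simp)
lemma C_mem : Ct Q ∈ PP x y := Subgroup.subset_closure (by simp)
lemma W_mem : Wt x y ∈ PP x y := by rw [Wt_eq]; exact mul_mem τ_mem (inv_mem X_mem)
lemma eZ_mem (j : ℤ) : eZ (Xt x) (Wt x y) j ∈ PP x y :=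
  mul_mem (mul_mem (zpow_mem W_mem _) X_mem) (zpow_mem W_mem _)

lemma PP_par {p : Q × GL3} (hp : p ∈ PP x y) : Par p.2 := by
  induction hp using Subgroup.closure_induction with
  | mem u hu =>
    rcases hu with rfl | rfl | rfl
    · exact xg_U.par
    · exact Par_Dm (k := 1) τg_val
    · exact Par_Dm (k := 1) (scal_val' 1)
  | one => exact Par.one
  | mul a b _ _ h1 h2 => exact h1.mul h2
  | inv a _ h => exact h.inv

lemma real_alpha (α : R2) : ∃ u ∈ PP x y, ∃ β, IsU u.2 α β := by
  induction α using R2_ind with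
  | h0 => exact ⟨1, one_mem _, 0, IsU.one⟩
  | hT k =>
    obtain ⟨b, hb⟩ := eZ_U k
    exact ⟨_, eZ_mem k, b, hb⟩
  | ha f g hf hg =>
    obtain ⟨u, hu, b, hb⟩ := hf
    obtain ⟨u', hu', b', hb'⟩ := hg
    exact ⟨u * u', mul_mem hu hu', _, hb.mul hb'⟩

lemma yk_PP (k : ℕ) : yk x y k ∈ PP x y := by
  unfold yk
  split_ifs
  · exact pow_mem X_mem 2
  · have h : eN (Xt x) (Wt x y) k ∈ PP x y := by rw [← eZ_nat]; exact eZ_mem _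
    exact mul_mem (mul_mem (mul_mem (inv_mem X_mem) (inv_mem h)) X_mem) h

lemma real_beta (f : R2) : ∃ u ∈ PP x y, ∃ s, Vge 1 (s + f) ∧ IsU u.2 0 ((1 + tt) * s) := by
  induction f using R2_ind with
  | h0 => exact ⟨1, one_mem _, 0, by simpa using Vge.zero 1, by simpa using IsU.one⟩
  | hT k =>
    by_cases h : 1 ≤ k
    · exact ⟨1, one_mem _, 0, by rw [zero_add]; exact Vge.Tle h, by simpa using IsU.one⟩
    · obtain ⟨j, rfl⟩ : ∃ j : ℕ, k = -j := ⟨(-k).toNat, by omega⟩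
      refine ⟨yk x y j, yk_PP j, sk j, ?_, yk_snd j⟩
      unfold sk
      split_ifs with h0
      · rw [h0]; simp only [Nat.cast_zero, neg_zero, T_zero]; rw [addself]; exact Vge.zero _
      · rw [add_assoc, addself, add_zero]; exact Vge.Tle (by omega)
  | ha f g hf hg =>
    obtain ⟨u, hu, b, hb1, hb⟩ := hf
    obtain ⟨u', hu', b', hb1', hb'⟩ := hg
    refine ⟨u * u', mul_mem hu hu', b + b', ?_, (hb.mul hb').congr (by ring) (by rw [map_zero]; ring)⟩
    rw [show b + b' + (f + g) = (b + f) + (b' + g) by ring]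
    exact hb1.add hb1'

end cov


lemma min_row {M : Lt} (hM : IsLat M) : ∃ b, (∃ y ∈ zero2 M, y 1 = T b) ∧ ∀ z ∈ zero2 M, Vge b (z 1) := by
  obtain ⟨K, hK⟩ := zero2_big hM
  obtain ⟨K', hK'⟩ := hM.small
  obtain ⟨b, ⟨z, hz, hb⟩, hmin⟩ := Int.exists_least_of_bdd (P := fun m => ∃ z ∈ zero2 M, Vex m (z 1))
    ⟨K', by
      rintro m ⟨z, hz, h⟩
      by_contra hc
      have := hK' z hz.1 1 m (by omega)
      rw [h.2] at this
      exact one_ne_zero this⟩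
    ⟨K, Pi.single 1 (T K), hK _ (Vge.Tk K), by
      rw [Pi.single_eq_same]; exact ⟨Vge.Tk K, by rw [coeff_T, if_pos rfl]⟩⟩
  refine ⟨b, lemE (zero2_smul hM) hK hz hb, ?_⟩
  intro z hz
  by_cases h : z 1 = 0
  · rw [h]; exact Vge.zero _
  · obtain ⟨m, hm⟩ := exists_Vex h
    exact hm.1.mono (hmin m ⟨z, hz, hm⟩)

lemma T_inv_mul (k : ℤ) (f : R2) : T k * (T (-k) * f) = f := by
  rw [← mul_assoc, ← T_add]; simp
lemma T_inv_mul' (k : ℤ) (f : R2) : T (-k) * (T k * f) = f := by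
  rw [← mul_assoc, ← T_add]; simp

lemma add_cancel2 (a b : R2) : a + (a + b) = b := by rw [← add_assoc, addself, zero_add]

lemma gen_w {R : Type*} [CommRing R] (two : (2:R) = 0) (c α β A Ai B h : R) (y2 y3 : Fin 3 → R) (hA : A * Ai = 1)
    (h3 : y3 2 = c) (h2 : y2 2 = 0) (h1 : y2 1 = B) (hB : h * B = c * α + y3 1) :
    c • ![β, α, 1] + (y3 + h • y2) = (Ai * (c * β + (y3 0 + h * y2 0))) • A • ![1, 0, 0] := by
  refine funext fun i => ?_
  fin_cases i
  · simp
    linear_combination -(c * β + (y3 0 + h * y2 0)) * hA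
  · simp
    rw [h1]
    linear_combination hB + (c * α + y3 1) * two
  · simp
    rw [h3, h2]
    linear_combination c * two

set_option maxHeartbeats 1000000 in
lemma F2core {Q : Type*} [Group Q] {x y : Q} {M : Lt} (hM : IsLat M) (h1 : HLe M 1) (h2 : ¬ HLe M 0) :
    ∃ p ∈ PP x y, HLe (act (p.2 * Jg)⁻¹ M) 0 := by
  obtain ⟨a, h3, h4⟩ := h1
  have h4' : ∀ z ∈ M, Vge (a - (0 + 1)) (z 2) := by simpa using h4
  obtain ⟨y0, hy0, hv0⟩ := tops h3 h4' h2
  obtain ⟨K, hK⟩ := hM.single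
  obtain ⟨y3, hy3, e3'⟩ := lemE hM.smul (hK 2) hy0 hv0
  rw [zero_add] at e3' h4'
  obtain ⟨b, ⟨y2, hy2, e2⟩, hmin⟩ := min_row hM
  obtain ⟨g, hg⟩ := div_one_add (T (-b) * y2 0) (a - b)
  obtain ⟨α, hα, hα'⟩ := trunc_two (T (-(a-1)) * y3 1) g (b - a + 1)
  obtain ⟨u0, hu0, β0, hU0⟩ := real_alpha (x := x) (y := y) α
  set hh : R2 := T (-b) * (T (a-1) * α + y3 1) with hhd
  obtain ⟨f0, hf0⟩ := div_one_add (β0 + T (-(a-1)) * (y3 0 + hh * y2 0)) 1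
  obtain ⟨uz, huz, s, hs, hUz⟩ := real_beta (x := x) (y := y) f0
  have hU := hU0.mul hUz
  set β : R2 := β0 + (1 + tt) * s with hβ
  replace hU : IsU (u0 * uz).2 α β := by
    rw [mul_zero, add_zero, add_zero] at hU
    exact hU
  refine ⟨u0 * uz, mul_mem hu0 huz, ?_⟩
  rw [HLe_uJ]
  have line : ∀ z ∈ M, z 1 = 0 → z 2 = 0 → Vge a (z 0) := fun z hz q1 q2 =>
    e1_line hM (n := 0) (by simpa using h4) h2 hz q1 q2
  -- w
  have hβ1 : Vge 1 (β + T (-(a-1)) * (y3 0 + hh * y2 0)) := by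
    have q := ((Vge.one.add (Vge.tt'.mono (by omega))).mul0 hs).add hf0
    convert q using 1
    rw [hβ]
    linear_combination (-(1+tt) * f0) * two_R2
  have hh0 : Vge 0 hh := by
    rw [hhd, Vge.Tmul_iff]
    have : T (a-1) * α + y3 1 = T (a-1) * (α + T (-(a-1)) * y3 1) := by
      rw [mul_add, T_inv_mul]
    rw [this, Vge.Tmul_iff]
    exact hα.mono (by omega)
  have hw : (T (a-1) : R2) • ((u0*uz).2.val *ᵥ e3) ∈ M := by
    have q1 : (T (a-1) : R2) • ((u0*uz).2.val *ᵥ e3) + (y3 + hh • y2) =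
       (T (-a) * (T (a-1) * β + (y3 0 + hh * y2 0))) • (T a : R2) • e1 := by
      rw [hU.e3]
      refine gen_w two_R2 _ _ _ _ _ (T b) _ _ _ (by rw [← T_add, add_neg_cancel, T_zero]) e3' hy2.2 e2 ?_
      rw [hhd, mul_comm _ (T b), T_inv_mul]
    have q2 : (T (-a) * (T (a-1) * β + (y3 0 + hh * y2 0))) • (T a : R2) • e1 ∈ M := by
      refine hM.smul _ ?_ _ h3
      rw [Vge.Tmul_iff]
      have : T (a-1) * β + (y3 0 + hh * y2 0) = T (a-1) * (β + T (-(a-1)) * (y3 0 + hh * y2 0)) := by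
        rw [mul_add _ β, T_inv_mul]
      rw [this, Vge.Tmul_iff]
      exact hβ1.mono (by omega)
    rw [← q1] at q2
    have := add_mem q2 (add_mem hy3 (hM.smul _ hh0 _ hy2.1))
    rwa [add_assoc, vaddself, add_zero] at this
  refine ⟨a - 1, hw, ?_⟩
  have hrow := hU.inv.row
  set w : V3 := (T (a-1) : R2) • ((u0*uz).2.val *ᵥ e3) with hwd
  have w2 : w 2 = T (a-1) := by rw [hwd, hU.e3]; simp
  have lw : ((u0*uz).2⁻¹.val *ᵥ w) 0 = 0 := by
    rw [hwd, Matrix.mulVec_smul, inv_mulVec]; simp [e3]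
  have ly2 : Vge a (((u0*uz).2⁻¹.val *ᵥ y2) 0) := by
    rw [hrow, e2, hy2.2, mul_zero, add_zero]
    have : y2 0 + (1 + tt) * bar α * T b = T b * ((1 + tt) * (bar α + g) + ((1+tt) * g + T (-b) * y2 0)) := by
      have := T_inv_mul b (y2 0)
      linear_combination -this - (T b) * (1+tt) * g * two_R2
    rw [this, Vge.Tmul_iff]
    exact ((Vge.one.add (Vge.tt'.mono (by omega))).mul0 (hα'.mono (by omega))).add hg
  intro z hz
  have d0 : Vge 0 (T (-(a-1)) * z 2) := by
    rw [Vge.Tmul_iff]; exact (h4 z hz).mono (by omega)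
  set z' : V3 := z + (T (-(a-1)) * z 2) • w with hz'
  have z'M : z' ∈ zero2 M := ⟨add_mem hz (hM.smul _ d0 _ hw), by
    rw [hz', Pi.add_apply, smul_two, w2, mul_comm, T_inv_mul, addself]⟩
  have d1 : Vge 0 (T (-b) * z' 1) := by
    rw [Vge.Tmul_iff]; exact (hmin z' z'M).mono (by omega)
  set z'' : V3 := z' + (T (-b) * z' 1) • y2 with hz''
  have z''M : z'' ∈ zero2 M := add_mem z'M (zero2_smul hM _ d1 _ hy2)
  have z''1 : z'' 1 = 0 := by
    rw [hz'', Pi.add_apply, smul_two, e2, mul_comm, T_inv_mul, addself]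
  have l'' : ((u0*uz).2⁻¹.val *ᵥ z'') 0 = z'' 0 := by
    rw [hrow, z''1, z''M.2, mul_zero, mul_zero, add_zero, add_zero]
  have ez : z = z'' + (T (-b) * z' 1) • y2 + (T (-(a-1)) * z 2) • w := by
    rw [hz'', hz', add_assoc (z + _) , vaddself, add_zero, add_assoc, vaddself, add_zero]
  have el : ((u0*uz).2⁻¹.val *ᵥ z) 0 = z'' 0 + (T (-b) * z' 1) * ((u0*uz).2⁻¹.val *ᵥ y2) 0 := by
    conv_lhs => rw [ez]
    rw [Matrix.mulVec_add, Matrix.mulVec_add, Matrix.mulVec_smul, Matrix.mulVec_smul, Pi.add_apply, Pi.add_apply,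
      smul_two, smul_two, lw, l'', mul_zero, add_zero]
  rw [el]
  have := (line z'' z''M.1 z''1 z''M.2).add (d1.mul0 ly2)
  exact this.mono (by omega)


section DCs
variable {Q : Type*} [Group Q] {x y t : Q}

def DC (x y : Q) (g : Q × GL3) : Prop := g ∈ PP x y ∨ ∃ p ∈ PP x y, ∃ p' ∈ PP x y, g = p * Jt x y * p'

lemma DC.left {g p : Q × GL3} (h : DC x y g) (hp : p ∈ PP x y) : DC x y (p * g) := by
  rcases h with h | ⟨p1, h1, p2, h2, rfl⟩
  · exact Or.inl (mul_mem hp h)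
  · exact Or.inr ⟨p * p1, mul_mem hp h1, p2, h2, by group⟩

lemma DC.right {g p : Q × GL3} (h : DC x y g) (hp : p ∈ PP x y) : DC x y (g * p) := by
  rcases h with h | ⟨p1, h1, p2, h2, rfl⟩
  · exact Or.inl (mul_mem h hp)
  · exact Or.inr ⟨p1, h1, p2 * p, mul_mem h2 hp, by group⟩

lemma Jt_inv : (Jt x y)⁻¹ = Jt x y * (τt x y)⁻¹ := by
  unfold τt; group

lemma Jt_comm_τ (m : ℤ) : Jt x y * τt x y ^ m = τt x y ^ m * Jt x y := by
  have : Commute (Jt x y) (τt x y) := by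
    show Jt x y * (Jt x y * Jt x y) = (Jt x y * Jt x y) * Jt x y
    rw [mul_assoc]
  exact this.zpow_right m

lemma DC.J : DC x y (Jt x y) := Or.inr ⟨1, one_mem _, 1, one_mem _, by group⟩

lemma DC.inv {g : Q × GL3} (h : DC x y g) : DC x y g⁻¹ := by
  rcases h with h | ⟨p1, h1, p2, h2, rfl⟩
  · exact Or.inl (inv_mem h)
  · refine Or.inr ⟨p2⁻¹, inv_mem h2, (τt x y)⁻¹ * p1⁻¹, mul_mem (inv_mem τ_mem) (inv_mem h1), ?_⟩
    rw [_root_.mul_inv_rev, _root_.mul_inv_rev, Jt_inv]; group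

lemma Jx3t (hq : QH x y t) : (Jt x y * (Xt x)⁻¹)^3 = Ct Q := by
  refine Prod.ext ?_ ?_
  · show (y * x * x⁻¹)^3 = 1
    rw [mul_inv_cancel_right, hq.y3]
  · exact Jx3

lemma DC.Xi (hq : QH x y t) : DC x y ((Jt x y)⁻¹ * (Xt x)⁻¹ * Jt x y) := by
  refine Or.inr ⟨(τt x y)⁻¹ * Ct Q * Xt x, mul_mem (mul_mem (inv_mem τ_mem) C_mem) X_mem, 
    (τt x y)⁻¹ * Xt x, mul_mem (inv_mem τ_mem) X_mem, ?_⟩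
  rw [← Jx3t hq, pow_three]
  unfold τt
  group

lemma DC.X (hq : QH x y t) : DC x y ((Jt x y)⁻¹ * (Xt x) * Jt x y) := by
  have := (DC.Xi hq).inv
  convert this using 1
  group

lemma DC.conj (hq : QH x y t) {u : Q × GL3} (hu : u ∈ PP x y) {α β : R2} (hU : IsU u.2 α β)
    (hβ : β = 0 ∨ β = 1 ∨ β = tt) : DC x y ((Jt x y)⁻¹ * u * Jt x y) := by
  have key : ∀ v ∈ PP x y, IsU v.2 α β → u = v := by
    intro v hv hV
    have := HP hq (mul_mem hu (inv_mem hv)) (by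
      show u.2 * v.2⁻¹ = 1
      rw [hU.ext hV, mul_inv_cancel])
    exact mul_inv_eq_one.mp this
  have hrel := hU.rel
  have cj : ∀ (j : ℤ) (v : Q × GL3), DC x y ((Jt x y)⁻¹ * v * Jt x y) → 
      DC x y ((Jt x y)⁻¹ * (τt x y ^ (-j) * v * τt x y ^ (- -j)) * Jt x y) := by
    intro j v h
    have e1 := Jt_comm_τ (x := x) (y := y) (-j)
    have e2 := Jt_comm_τ (x := x) (y := y) (- -j)
    have e3 : (Jt x y)⁻¹ * τt x y ^ (-j) = τt x y ^ (-j) * (Jt x y)⁻¹ := by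
      rw [inv_mul_eq_iff_eq_mul, ← mul_assoc, e1, mul_inv_cancel_right]
    have := (h.left (zpow_mem τ_mem (-j))).right (zpow_mem τ_mem (- -j))
    convert this using 1
    rw [← mul_assoc, ← mul_assoc, e3, mul_assoc _ (τt x y ^ (- -j)), ← e2]
    group
  have al : β ≠ 0 → (1 + tt) * (α * bar α) = 1 + tt → ∃ j, α = T j := by
    intro _ h
    have : α * bar α = 1 := by
      apply mul_left_cancel₀ one_add_tt_ne
      rw [h, mul_one]
    exact unit_T this
  rcases hβ with h | h | h
  · have hα : α = 0 := by
      rw [h, show bar 0 = 0 by simp, mul_zero, add_zero, mul_assoc] at hrel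
      rcases mul_eq_zero.mp hrel.symm with h1 | h1
      · exact absurd h1 one_add_tt_ne
      · rcases mul_eq_zero.mp h1 with h1 | h1
        · exact h1
        · have := congrArg bar h1
          rwa [bar_bar, show bar 0 = 0 by simp] at this
    rw [key 1 (one_mem _) (by rw [hα, h]; exact IsU.one)]
    left; simp
  · obtain ⟨j, hj⟩ := al (by rw [h]; exact one_ne_zero) (by
      rw [h, show bar 1 = 1 by simp, mul_one] at hrel
      rw [← mul_assoc, ← hrel])
    rw [key (τt x y ^ (-j) * (Xt x)⁻¹ * τt x y ^ (- -j)) (mul_mem (mul_mem (zpow_mem τ_mem _) (inv_mem X_mem))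
      (zpow_mem τ_mem _)) (by
        have := xgi_U.conj_τ (-j)
        rw [neg_neg, mul_one, ← hj, ← h] at this
        rw [neg_neg]
        exact this)]
    exact cj j _ (DC.Xi hq)
  · obtain ⟨j, hj⟩ := al (by rw [h]; exact tt_ne) (by
      rw [h, bar_tt, tt_ti] at hrel
      rw [← mul_assoc, ← hrel]; ring)
    rw [key (τt x y ^ (-j) * (Xt x) * τt x y ^ (- -j)) (mul_mem (mul_mem (zpow_mem τ_mem _) X_mem)
      (zpow_mem τ_mem _)) (by
        have := xg_U.conj_τ (-j)
        rw [neg_neg, mul_one, ← hj, ← h] at this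
        rw [neg_neg]
        exact this)]
    exact cj j _ (DC.X hq)

end DCs

lemma supp_one {m : ℤ} {β : R2} (h1 : Vge m β) (h2 : Vge (-m) (bar β)) : β = 0 ∨ β = T m := by
  have hz : ∀ k, k ≠ m → β.coeff k = 0 := by
    intro k hk
    rcases lt_or_gt_of_ne hk with h | h
    · exact h1 k h
    · have := h2 (-k) (by omega)
      rw [bar_coeff, neg_neg] at this
      exact this
  have h01 : β.coeff m = 0 ∨ β.coeff m = 1 := by
    generalize β.coeff m = c
    revert c; decide
  rcases h01 with h | h
  · left
    ext k
    by_cases hk : k = m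
    · rw [hk, h]; simp
    · rw [hz k hk]; simp
  · right
    ext k
    rw [coeff_T]
    by_cases hk : k = m
    · rw [hk, h]; simp
    · rw [hz k hk, if_neg (Ne.symm hk)]

lemma HLe_act_sc {g : GL3} {M : Lt} {h : ℤ} (k : ℤ) : HLe (act g (sc k M)) h ↔ HLe (act g M) h := by
  rw [show act g (sc k M) = sc k (act g M) by unfold sc; rw [← act_mul, ← act_mul, scal_central], HLe_sc]

lemma ee1_0 : (e1 0) = 1 := rfl
lemma ee1_1 : (e1 1) = 0 := rfl
lemma ee1_2 : (e1 2) = 0 := rfl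
lemma ee3_2 : (e3 2) = 1 := rfl
lemma ee3_1 : (e3 1) = 0 := rfl
lemma ee3_0 : (e3 0) = 0 := rfl

lemma Tcore {L L' L'' : Lt} (hL : IsLat L) (c : HLe L 0) (c' : HLe (act (Jg)⁻¹ L') 0) {u : GL3} {α β : R2}
    (hU : IsU u α β) (c'' : HLe (act (u * Jg)⁻¹ L'') 0) (n1 : near L L') (n2 : near L L'') (n3 : near L' L'') :
    β = 0 ∨ β = 1 ∨ β = tt := by
  obtain ⟨k', s'⟩ := n1.sand
  obtain ⟨k'', s''⟩ := n2.sand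
  rw [← near_sc k'', ← near_sc' k'] at n3
  rw [← HLe_act_sc k'] at c'
  rw [← HLe_act_sc k''] at c''
  clear n1 n2
  generalize sc k' L' = L' at *
  generalize sc k'' L'' = L'' at *
  obtain ⟨a, a1, a2⟩ := c
  rw [HLe_uJ] at c''
  rw [← one_mul Jg, HLe_uJ] at c'
  obtain ⟨b, b1, b2⟩ := c'
  obtain ⟨d, d1, d2⟩ := c''
  have hrow := hU.inv.row
  rw [hU.e3] at d1
  simp only [inv_one, Units.val_one, Matrix.one_mulVec] at b1 b2
  simp only [hrow] at d2
  rw [sub_zero] at a2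
  have E1 : (T (a+1) : R2) • e1 ∈ L' := by
    have := s'.2 _ a1; rwa [T_smul_smul_eq (add_comm 1 a)] at this
  have E1' : (T (a+1) : R2) • e1 ∈ L'' := by
    have := s''.2 _ a1; rwa [T_smul_smul_eq (add_comm 1 a)] at this
  have f1 : a ≤ b := by
    have := a2 _ (s'.1 _ b1)
    rw [smul_two, ee3_2, mul_one] at this
    exact this.le_of_T
  have f2 : b + 1 ≤ a + 1 := by
    have := b2 _ E1
    rw [smul_two, ee1_0, mul_one] at this
    exact this.le_of_T
  have g1 : a ≤ d := by
    have := a2 _ (s''.1 _ d1)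
    rw [smul_two, show (![β, α, 1] : V3) 2 = 1 from rfl, mul_one] at this
    exact this.le_of_T
  have g2 : d + 1 ≤ a + 1 := by
    have := d2 _ E1'
    rw [smul_two, smul_two, smul_two, ee1_0, ee1_1, ee1_2, mul_one, mul_zero, mul_zero, mul_zero, add_zero, add_zero] at this
    exact this.le_of_T
  obtain rfl : b = a := by omega
  obtain rfl : d = b := by omega
  obtain ⟨k, n1, n2⟩ := n3
  have k0 : 0 ≤ k := by
    have := b2 _ (n1 _ E1')
    rw [T_smul_smul_eq rfl, smul_two, ee1_0, mul_one] at this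
    have := this.le_of_T
    omega
  have k1 : k ≤ 1 := by
    have := d2 _ (n2 _ E1)
    rw [T_smul_smul_eq rfl, smul_two, smul_two, smul_two, ee1_0, ee1_1, ee1_2, mul_one, mul_zero, mul_zero, mul_zero, add_zero, add_zero] at this
    have := this.le_of_T
    omega
  have v1 : Vge (1 - k) β := by
    have := b2 _ (n1 _ d1)
    rw [T_smul_smul_eq rfl, smul_two, show (![β, α, 1] : V3) 0 = β from rfl, Vge.Tmul_iff] at this
    exact this.mono (by omega)
  have v2 : Vge (-(1 - k)) (bar β) := by
    have := d2 _ (n2 _ b1)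
    rw [T_smul_smul_eq rfl, smul_two, smul_two, smul_two, ee3_0, ee3_1, ee3_2, mul_one, mul_zero, mul_zero, zero_add, zero_add,
      mul_comm, Vge.Tmul_iff, show tt = T 1 from rfl, Vge.Tmul_iff] at this
    exact this.mono (by omega)
  rcases supp_one v1 v2 with h | h
  · exact Or.inl h
  · right
    rcases (show k = 0 ∨ k = 1 by omega) with rfl | rfl
    · right; exact h
    · left; rw [h, sub_self, T_zero]

section DCs2
variable {Q : Type*} [Group Q] {x y t : Q}

def rel (x y : Q) (d d' : Q × GL3) : Prop := DC x y (d⁻¹ * d')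
def Cov (M : Lt) (d : Q × GL3) : Prop := HLe (act d.2⁻¹ M) 0

lemma rel.symm {d d' : Q × GL3} (h : rel x y d d') : rel x y d' d := by
  have := h.inv
  rwa [_root_.mul_inv_rev, inv_inv] at this

lemma rel.lmul {d d' : Q × GL3} (h : rel x y d d') (g : Q × GL3) : rel x y (g * d) (g * d') := by
  unfold rel; rw [show (g * d)⁻¹ * (g * d') = d⁻¹ * d' by group]; exact h

lemma rel.rmul {d d' p : Q × GL3} (h : rel x y d d') (hp : p ∈ PP x y) : rel x y d (d' * p) := by
  have := DC.right h hp
  unfold rel; convert this using 1; group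

lemma Cov.rmul {M : Lt} {d p : Q × GL3} (h : Cov M d) (hp : p ∈ PP x y) : Cov M (d * p) := by
  unfold Cov
  rw [Prod.snd_mul, _root_.mul_inv_rev, act_mul, (PP_par hp).inv.HLe_iff]
  exact h

lemma Cov.act {M : Lt} {d : Q × GL3} (h : Cov M d) (g : Q × GL3) : Cov (act g.2 M) (g * d) := by
  unfold Cov
  rw [Prod.snd_mul, ← act_mul, _root_.mul_inv_rev, inv_mul_cancel_right]
  exact h

lemma F2 {M M' : Lt} (hM' : IsLat M') {d : Q × GL3} (h : Cov M d) (hn : near M M') : 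
    ∃ d', Cov M' d' ∧ rel x y d d' := by
  by_cases hc : Cov M' d
  · exact ⟨d, hc, Or.inl (by rw [inv_mul_cancel]; exact one_mem _)⟩
  · have h1 : HLe (_root_.act d.2⁻¹ M') (0 + 1) := near.HLe (hn.act _) h
    rw [zero_add] at h1
    obtain ⟨p, hp, h2⟩ := F2core (x := x) (y := y) (hM'.act d.2⁻¹) h1 hc
    refine ⟨d * (p * Jt x y), ?_, Or.inr ⟨p, hp, 1, one_mem _, by group⟩⟩
    unfold Cov
    rw [Prod.snd_mul, _root_.mul_inv_rev, act_mul]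
    exact h2

lemma F3 {M : Lt} {d d' : Q × GL3} (hr : rel x y d d') (h : Cov M d) (h' : Cov M d') : d⁻¹ * d' ∈ PP x y := by
  rcases hr with hr | ⟨p, hp, p', hp', e⟩
  · exact hr
  · exfalso
    have h1 := h.rmul hp
    have h2 := h'.rmul (inv_mem hp')
    rw [show d' * p'⁻¹ = d * p * Jt x y by rw [mul_inv_eq_iff_eq_mul, ← mul_inv_cancel_left d d', e]; group] at h2
    unfold Cov at h1 h2
    rw [Prod.snd_mul, _root_.mul_inv_rev, act_mul, ← one_mul (Jt x y)] at h2
    have h3 := (HLe_uJ 1 _).mp h2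
    obtain ⟨a, a1, a2⟩ := h1
    obtain ⟨b, b1, b2⟩ := h3
    simp only [inv_one, Units.val_one, Matrix.one_mulVec] at b1 b2
    have f1 := a2 _ b1
    have f2 := b2 _ a1
    rw [smul_two, ee3_2, mul_one] at f1
    rw [smul_two, ee1_0, mul_one] at f2
    have := f1.le_of_T
    have := f2.le_of_T
    omega

lemma Tlem (hq : QH x y t) {M M' M'' : Lt} {d d' d'' : Q × GL3} (hM : IsLat M)
    (r1 : rel x y d d') (r2 : rel x y d d'') (c : Cov M d) (c' : Cov M' d') (c'' : Cov M'' d'')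
    (n1 : near M M') (n2 : near M M'') (n3 : near M' M'') : rel x y d' d'' := by
  rcases r1 with r1 | ⟨p, hp, p1, hp1, e⟩
  · have := DC.left r2 (inv_mem r1)
    unfold rel
    convert this using 1
    group
  rcases r2 with r2 | ⟨p2, hp2, p3, hp3, e'⟩
  · have := DC.right (rel.symm (Or.inr ⟨p, hp, p1, hp1, e⟩)) r2
    unfold rel
    convert this using 1
    group
  obtain ⟨k, m, u, α, β, hu, hU, eu⟩ := PP_form hq (mul_mem (inv_mem hp) hp2)
  have h0 := c.rmul hp
  have h1 := c'.rmul (inv_mem hp1)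
  have hp3' : τt x y ^ m * Ct Q ^ k * p3 ∈ PP x y := mul_mem (mul_mem (zpow_mem τ_mem _) (zpow_mem C_mem _)) hp3
  have h2 := c''.rmul (inv_mem hp3')
  have ed : d' * p1⁻¹ = d * p * Jt x y := by 
    rw [mul_inv_eq_iff_eq_mul, ← mul_inv_cancel_left d d', e]; group
  have ep2 : p2 = p * (u * τt x y ^ m * Ct Q ^ k) := by rw [← eu]; group
  have ed' : d'' * (τt x y ^ m * Ct Q ^ k * p3)⁻¹ = d * p * (u * Jt x y) := by
    rw [mul_inv_eq_iff_eq_mul, ← mul_inv_cancel_left d d'', e', ep2]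
    have q1 : Ct Q ^ k * Jt x y = Jt x y * Ct Q ^ k := ((Ct_comm (Jt x y)).zpow_left k)
    have q2 := Jt_comm_τ (x := x) (y := y) m
    calc _ = d * (p * (u * (τt x y ^ m * (Ct Q ^ k * Jt x y))) * p3) := by group
      _ = d * (p * (u * ((τt x y ^ m * Jt x y) * Ct Q ^ k)) * p3) := by rw [q1]; group
      _ = _ := by rw [← q2]; group
  rw [ed] at h1
  rw [ed'] at h2
  unfold Cov at h0 h1 h2
  rw [Prod.snd_mul _ (Jt x y), _root_.mul_inv_rev, act_mul] at h1
  rw [Prod.snd_mul _ (u * Jt x y), _root_.mul_inv_rev, act_mul] at h2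
  have hβ := Tcore (hM.act (d * p).2⁻¹) h0 h1 hU h2 (n1.act _) (n2.act _) (n3.act _)
  have := ((DC.conj hq hu hU hβ).left (inv_mem hp1)).right hp3'
  unfold rel
  convert this using 1
  have e1 : d' = d * p * Jt x y * p1 := by rw [← ed]; group
  have e2 : d'' = d * p * (u * Jt x y) * (τt x y ^ m * Ct Q ^ k * p3) := by rw [← ed']; group
  rw [e1, e2]; group

end DCs2


section Sns
variable {Q : Type*} [Group Q] {x y t : Q}

def Sn (x y : Q) : ℕ → Lt → Q × GL3 → Prop
  | 0, _, d => d ∈ PP x y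
  | n+1, M, d => (HLe M (n : ℤ) ∧ Sn x y n M d) ∨ (¬ HLe M (n : ℤ) ∧ ∃ N e, IsLat N ∧ near M N ∧ HLe N (n : ℤ) ∧
      Sn x y n N e ∧ rel x y e d ∧ Cov M d)

lemma Sn_cov : ∀ (n : ℕ) {M : Lt} {d : Q × GL3}, HLe M (n : ℤ) → Sn x y n M d → Cov M d := by
  intro n
  induction n with
  | zero =>
    intro M d h hd
    unfold Cov
    rw [(PP_par hd).inv.HLe_iff]
    exact h
  | succ n ih =>
    intro M d h hd
    rcases hd with ⟨h1, h2⟩ | ⟨_, N, e, _, _, _, _, _, h2⟩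
    · exact ih h1 h2
    · exact h2

lemma Sn_ex : ∀ (n : ℕ) {M : Lt}, IsLat M → HLe M (n : ℤ) → ∃ d : Q × GL3, Sn x y n M d := by
  intro n
  induction n with
  | zero => intro M _ _; exact ⟨1, one_mem _⟩
  | succ n ih =>
    intro M hM h
    by_cases hc : HLe M (n : ℤ)
    · obtain ⟨d, hd⟩ := ih hM hc
      exact ⟨d, Or.inl ⟨hc, hd⟩⟩
    · push_cast at h
      obtain ⟨N, hN, hn, hNh⟩ := F1a hM h hc
      obtain ⟨e, he⟩ := ih hN hNh
      obtain ⟨d, c, r⟩ := F2 (x := x) (y := y) hM (Sn_cov n hNh he) hn.symm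
      exact ⟨d, Or.inr ⟨hc, N, e, hN, hn, hNh, he, r, c⟩⟩

lemma Sn_mixed (hq : QH x y t) (n : ℕ) (ih : ∀ {M M' : Lt} {d d' : Q × GL3}, IsLat M → IsLat M' → near M M' → 
    HLe M (n : ℤ) → HLe M' (n : ℤ) → Sn x y n M d → Sn x y n M' d' → rel x y d d')
    {M M' : Lt} {d d' : Q × GL3} (hM : IsLat M) (hM' : IsLat M') (hn : near M M') (h : HLe M (n : ℤ))
    (h' : HLe M' ((n : ℤ) + 1)) (hc : ¬ HLe M' (n : ℤ)) (hd : Sn x y n M d) {N : Lt} {e : Q × GL3} (hN : IsLat N)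
    (hnN : near M' N) (hNh : HLe N (n : ℤ)) (he : Sn x y n N e) (r : rel x y e d') (c : Cov M' d') : rel x y d d' := by
  have hb := F1b hM' hN hM h' hc hnN hn.symm hNh h
  have h1 := ih hN hM hb hNh h he hd
  exact Tlem hq hN h1 r (Sn_cov n hNh he) (Sn_cov n h hd) c hb hnN.symm hn

lemma Sn_uniq (hq : QH x y t) : ∀ (n : ℕ) {M M' : Lt} {d d' : Q × GL3}, IsLat M → IsLat M' → near M M' → 
    HLe M (n : ℤ) → HLe M' (n : ℤ) → Sn x y n M d → Sn x y n M' d' → rel x y d d' := by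
  intro n
  induction n with
  | zero =>
    intro M M' d d' _ _ _ _ _ hd hd'
    exact Or.inl (mul_mem (inv_mem hd) hd')
  | succ n ih =>
    intro M M' d d' hM hM' hn h h' hd hd'
    push_cast at h h'
    rcases hd with ⟨h1, h2⟩ | ⟨hc, N, e, hN, hnN, hNh, he, r, c⟩
    · rcases hd' with ⟨h1', h2'⟩ | ⟨hc', N', e', hN', hnN', hNh', he', r', c'⟩
      · exact ih hM hM' hn h1 h1' h2 h2'
      · exact Sn_mixed hq n ih hM hM' hn h1 h' hc' h2 hN' hnN' hNh' he' r' c'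
    · rcases hd' with ⟨h1', h2'⟩ | ⟨hc', N', e', hN', hnN', hNh', he', r', c'⟩
      · exact (Sn_mixed hq n ih hM' hM hn.symm h1' h hc h2' hN hnN hNh he r c).symm
      · obtain ⟨N0, hN0, n0, n0', h0⟩ := F1c hM hM' h hc h' hc' hn
        obtain ⟨e0, he0⟩ := Sn_ex (x := x) (y := y) n hN0 h0
        have a1 := Sn_mixed hq n ih hN0 hM n0.symm h0 h hc he0 hN hnN hNh he r c
        have a2 := Sn_mixed hq n ih hN0 hM' n0'.symm h0 h' hc' he0 hN' hnN' hNh' he' r' c'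
        exact Tlem hq hN0 a1 a2 (Sn_cov n h0 he0) c c' n0.symm n0'.symm hn

def L0 : Lt where
  carrier := {z | ∀ i, Vge 0 (z i)}
  add_mem' := fun h h' i => (h i).add (h' i)
  zero_mem' := fun i => Vge.zero 0
  neg_mem' := by
    intro z h i
    have : (-z) = z := by rw [neg_eq_iff_add_eq_zero, vaddself]
    rw [this]; exact h i

lemma mem_L0 {z : V3} : z ∈ L0 ↔ ∀ i, Vge 0 (z i) := Iff.rfl

lemma L0_lat : IsLat L0 := by
  refine ⟨?_, ⟨0, fun z h => h⟩, ⟨0, fun z h => h⟩⟩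
  intro f hf z hz i
  rw [smul_two]; exact hf.mul0 (hz i)

lemma L0_HLe : HLe L0 0 := by
  refine ⟨0, ?_, fun z hz => hz 2⟩
  rw [T_zero, one_smul]
  intro i
  fin_cases i
  · exact Vge.one
  · exact Vge.zero _
  · exact Vge.zero _

lemma mulVec_Vge {m : M3} {k : ℤ} (hm : ∀ i j, Vge k (m i j)) {z : V3} (hz : z ∈ L0) (i : Fin 3) : Vge k ((m *ᵥ z) i) := by
  show Vge k (∑ j, m i j * z j)
  refine Vge.sum _ _ fun j _ => ?_
  have := (hm i j).mul (hz j)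
  rwa [add_zero] at this

lemma near_of {g : GL3} (k : ℤ) (h1 : ∀ i j, Vge (-k) (g.val i j)) (h2 : ∀ i j, Vge (k-1) (g⁻¹.val i j)) : near L0 (act g L0) := by
  refine ⟨k, ?_, ?_⟩
  · intro z hz i
    rw [mem_act] at hz
    have := mulVec_Vge h1 hz i
    rw [mulVec_inv] at this
    rw [smul_two, Vge.Tmul_iff]
    exact this.mono (by omega)
  · intro z hz
    rw [mem_act]
    intro i
    have := mulVec_Vge h2 hz i
    rw [Matrix.mulVec_smul, smul_two, Vge.Tmul_iff]
    exact this.mono (by omega)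

lemma near_step {s : GL3} (h : near L0 (act s L0)) : near L0 (act s⁻¹ L0) := by
  have := h.act s⁻¹
  rw [← act_mul, inv_mul_cancel, act_one] at this
  exact this.symm

lemma near_J : near L0 (act Jg L0) := by
  have v0 : Vge 0 (0 : R2) := Vge.zero 0
  have v0' : Vge (-1) (0 : R2) := Vge.zero _
  have v1 : Vge 0 (1 : R2) := Vge.one
  have v1' : Vge (-1) (1 : R2) := Vge.one.mono (by omega)
  have vt : Vge 0 tt := Vge.tt'.mono (by omega)
  have vi : Vge (-1) ti := Vge.Tk (-1)
  refine near_of 0 ?_ ?_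
  · intro i j
    show Vge 0 ((!![0,0,tt; 0,1,0; 1,0,0] : M3) i j)
    fin_cases i <;> fin_cases j
    exacts [v0, v0, vt, v0, v1, v0, v1, v0, v0]
  · intro i j
    show Vge (-1) ((!![0,0,1;0,1,0;ti,0,0] : M3) i j)
    fin_cases i <;> fin_cases j
    exacts [v0', v0', v1', v0', v1', v0', vi, v0', v0']

lemma Um_Vge {b : R2} (hb : Vge 0 b) (i j : Fin 3) : Vge 0 (Um 1 b i j) := by
  have v0 : Vge 0 (0 : R2) := Vge.zero 0
  have v1 : Vge 0 (1 : R2) := Vge.one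
  have v2 : Vge 0 ((1 + tt) * bar 1) := by
    rw [map_one, mul_one]; exact Vge.one.add (Vge.tt'.mono (by omega))
  show Vge 0 ((!![1, (1+tt)*bar 1, b; 0, 1, 1; 0, 0, 1] : M3) i j)
  fin_cases i <;> fin_cases j
  exacts [v1, v2, hb, v0, v1, v1, v0, v0, v1]

lemma near_x : near L0 (act xg L0) := by
  refine near_of 0 ?_ ?_
  · intro i j
    rw [xg_U.val]
    exact Um_Vge (Vge.tt'.mono (by omega)) i j
  · intro i j
    rw [xgi_U.val]
    exact (Um_Vge Vge.one i j).mono (by omega)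

lemma near_C : near L0 (act (scal 1) L0) := (near_sc 1).mpr (near_refl L0_lat)

def GG (x y : Q) : Subgroup (Q × GL3) := Subgroup.closure {Xt x, Jt x y, Ct Q}

lemma A_step (hq : QH x y t) {g s : Q × GL3} (hs : near L0 (act s.2 L0)) (hr : DC x y s)
    (hA : ∀ (n : ℕ) (d : Q × GL3), HLe (act g.2 L0) (n : ℤ) → Sn x y n (act g.2 L0) d → g⁻¹ * d ∈ PP x y)
    (n : ℕ) (d' : Q × GL3) (h' : HLe (act (g * s).2 L0) (n : ℤ)) (hd' : Sn x y n (act (g*s).2 L0) d') : 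
    (g * s)⁻¹ * d' ∈ PP x y := by
  have hn : near (act g.2 L0) (act (g * s).2 L0) := by
    rw [Prod.snd_mul, act_mul]; exact hs.act _
  have h1 : HLe (act g.2 L0) ((n+1 : ℕ) : ℤ) := by
    push_cast; exact near.HLe hn.symm h'
  obtain ⟨d, hd⟩ := Sn_ex (x := x) (y := y) (n+1) (L0_lat.act g.2) h1
  have hg := hA _ _ h1 hd
  have c' : Cov (act (g*s).2 L0) d' := Sn_cov n h' hd'
  have h'' : HLe (act (g * s).2 L0) ((n+1 : ℕ) : ℤ) := h'.mono (by push_cast; omega)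
  have hd'' : Sn x y (n+1) (act (g*s).2 L0) d' := Or.inl ⟨h', hd'⟩
  have r1 := Sn_uniq hq (n+1) (L0_lat.act _) (L0_lat.act _) hn h1 h'' hd hd''
  have r2 : rel x y g d' := by
    have := DC.left r1 hg
    unfold rel
    convert this using 1
    group
  have r3 : rel x y g (g * s) := by
    unfold rel; rwa [inv_mul_cancel_left]
  have cov1 : Cov L0 (1 : Q × GL3) := by
    unfold Cov
    rw [Prod.snd_one, inv_one, act_one]
    exact L0_HLe
  have cg : ∀ g : Q × GL3, Cov (act g.2 L0) g := by
    intro g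
    have := cov1.act g
    rwa [mul_one] at this
  have r4 := Tlem hq (L0_lat.act _) r2 r3 (cg g) c' (cg (g*s)) hn hn (near_refl (L0_lat.act _))
  exact F3 r4.symm (cg _) c'

lemma A_all (hq : QH x y t) {g : Q × GL3} (hg : g ∈ GG x y) : 
    ∀ (n : ℕ) (d : Q × GL3), HLe (act g.2 L0) (n : ℤ) → Sn x y n (act g.2 L0) d → g⁻¹ * d ∈ PP x y := by
  have gen : ∀ s ∈ ({Xt x, Jt x y, Ct Q} : Set (Q × GL3)), near L0 (act s.2 L0) ∧ DC x y s := by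
    intro s hs
    rcases hs with rfl | rfl | rfl
    · exact ⟨near_x, Or.inl X_mem⟩
    · exact ⟨near_J, DC.J⟩
    · exact ⟨near_C, Or.inl C_mem⟩
  induction hg using Subgroup.closure_induction_right with
  | one =>
    intro n
    rw [Prod.snd_one, act_one]
    induction n with
    | zero =>
      intro d _ hd
      rw [inv_one, one_mul]; exact hd
    | succ n ih =>
      intro d _ hd
      have h0 : HLe L0 (n : ℤ) := L0_HLe.mono (by omega)
      rcases hd with ⟨_, h2⟩ | ⟨hc, _⟩
      · exact ih d h0 h2
      · exact absurd h0 hc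
  | mul_right g hg s hs ih => exact A_step hq (gen s hs).1 (gen s hs).2 ih
  | mul_inv_cancel g hg s hs ih => exact A_step hq (near_step (gen s hs).1) (gen s hs).2.inv ih

theorem main_inj (hq : QH x y t) {g : Q × GL3} (hg : g ∈ GG x y) (h1 : g.2 = 1) : g = 1 := by
  have := A_all hq hg 0 1 (by rw [h1, act_one]; exact L0_HLe) (one_mem _)
  rw [mul_one] at this
  have h2 := HP hq this (by rw [Prod.snd_inv, h1, inv_one])
  rwa [inv_eq_one] at h2

end Sns


def Bm : M3 := !![1,tt,1; 0,1+tt,1+tt; 1,1,1]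

lemma Bm_det : Bm.det = (1 + tt) * (1 + tt) := by
  unfold Bm
  rw [Matrix.det_fin_three]
  simp
  linear_combination (-1 - tt) * two_R2

lemma Bm_cancel {M N : M3} (h : Bm * M = Bm * N) : M = N := by
  have h1 := congrArg (fun z => Bm.adjugate * z) h
  simp only [← mul_assoc, Matrix.adjugate_mul] at h1
  rw [Matrix.smul_mul, Matrix.smul_mul, one_mul, one_mul, Bm_det] at h1
  refine Matrix.ext fun i j => ?_
  have h2 := congrFun (congrFun h1 i) j
  exact mul_left_cancel₀ (mul_ne_zero one_add_tt_ne one_add_tt_ne) h2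

lemma gen_X {R : Type*} [CommRing R] (two : (2:R) = 0) (s : R) : 
    (!![0,0,1; 1,0,1; 0,1,1] : Matrix (Fin 3) (Fin 3) R) * !![1,s,1; 0,1+s,1+s; 1,1,1] =
      !![1,s,1; 0,1+s,1+s; 1,1,1] * !![1,1+s,s;0,1,1;0,0,1] := by
  refine Matrix.ext fun i j => ?_
  fin_cases i <;> fin_cases j <;> simp [Matrix.mul_apply, Fin.sum_univ_three] <;> grind

lemma gen_Y {R : Type*} [CommRing R] (two : (2:R) = 0) (s : R) : 
    (!![0,0,1; s,1,1; 0,1,1] : Matrix (Fin 3) (Fin 3) R) * !![1,s,1; 0,1+s,1+s; 1,1,1] =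
      !![1,s,1; 0,1+s,1+s; 1,1,1] * (!![0,0,s; 0,1,0; 1,0,0] * !![1,1+s,1;0,1,1;0,0,1]) := by
  refine Matrix.ext fun i j => ?_
  fin_cases i <;> fin_cases j <;> simp [Matrix.mul_apply, Fin.sum_univ_three] <;> grind

lemma Xn_B : Xn.val * Bm = Bm * xg.val := by
  rw [xg_U.val]
  have := gen_X two_R2 tt
  unfold Um
  rw [map_one, mul_one]
  exact this

lemma Yn_B : Yn.val * Bm = Bm * (Jg * xg⁻¹).val := by
  rw [Units.val_mul, xgi_U.val, Yn_val]
  have := gen_Y two_R2 tt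
  unfold Um
  rw [map_one, mul_one]
  exact this

lemma q4x : qx ^ 4 = 1 := by
  have : (FreeGroup.of 0) ^ 4 ∈ q4Rels := by simp [q4Rels]
  have := PresentedGroup.one_of_mem this
  simpa [qx, PresentedGroup.of] using! this
lemma q4y : qy ^ 3 = 1 := by
  have : (FreeGroup.of 1) ^ 3 ∈ q4Rels := by simp [q4Rels]
  have := PresentedGroup.one_of_mem this
  simpa [qy, PresentedGroup.of] using! this
lemma q4w : Commute (qx ^ 2) (qy * qx * qy) := by
  have : br ((FreeGroup.of 0) ^ 2) (FreeGroup.of 1 * FreeGroup.of 0 * FreeGroup.of 1) ∈ q4Rels := by simp [q4Rels]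
  have h : br (qx ^ 2) (qy * qx * qy) = 1 := PresentedGroup.one_of_mem this
  unfold br at h
  rw [mul_assoc, ← _root_.mul_inv_rev, inv_mul_eq_one] at h
  exact h.symm

abbrev NN : Subgroup GrpG := Subgroup.normalClosure
        {br (εQ (qy * qx * qy)) (εQ qx) * tG * (εQ qx)⁻¹ * tG⁻¹}

def th : GrpG →* GrpG ⧸ NN := QuotientGroup.mk' NN

lemma hQH : QH (th (εQ qx)) (th (εQ qy)) (th tG) := by
  refine ⟨?_, ?_, ?_, ?_, ?_⟩
  · rw [← map_pow, ← map_pow, q4x, map_one, map_one]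
  · rw [← map_pow, ← map_pow, q4y, map_one, map_one]
  · have := (q4w.map εQ).map th
    simpa only [map_mul, map_pow] using this
  · have h : Commute tG (εQ (qy * qx * qy)) :=
      HNNExtension.t_mul_of (φ := MulEquiv.refl _) ⟨qy * qx * qy, Subgroup.mem_zpowers _⟩
    simpa only [map_mul] using h.map th
  · have h : th (br (εQ (qy * qx * qy)) (εQ qx) * tG * (εQ qx)⁻¹ * tG⁻¹) = 1 :=
      (QuotientGroup.eq_one_iff _).mpr (Subgroup.subset_normalClosure rfl)
    unfold br at h
    simp only [map_mul, map_inv] at h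
    generalize th (εQ qx) = x at *
    generalize th (εQ qy) = y at *
    generalize th tG = t at *
    have h2 : (y * x * y)⁻¹ * x⁻¹ * (y * x * y) * x * (t * x * t⁻¹)⁻¹ = 1 := by
      rw [← h]; group
    exact (mul_inv_eq_one.mp h2).symm

lemma lifts (γ : Q4 →* PGL3) (hγx : γ qx = pp X) (hγy : γ qy = pp Y) (q : Q4) :
    ∃ old new : GL3, γ q = pp old ∧ (th (εQ q), new) ∈ GG (th (εQ qx)) (th (εQ qy)) ∧ 
      old.val * Bm = Bm * new.val := by
  rw [pp_X] at hγx
  rw [pp_Y] at hγy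
  have hX : (th (εQ qx), xg) ∈ GG (th (εQ qx)) (th (εQ qy)) := Subgroup.subset_closure (Or.inl rfl)
  have hJ : Jt (th (εQ qx)) (th (εQ qy)) ∈ GG (th (εQ qx)) (th (εQ qy)) :=
    Subgroup.subset_closure (Or.inr (Or.inl rfl))
  have hq : q ∈ Subgroup.closure (Set.range (PresentedGroup.of : Fin 2 → Q4)) := by
    rw [PresentedGroup.closure_range_of]; trivial
  induction hq using Subgroup.closure_induction with
  | mem s hs =>
    obtain ⟨i, rfl⟩ := hs
    fin_cases i
    · exact ⟨Xn, xg, hγx, hX, Xn_B⟩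
    · refine ⟨Yn, Jg * xg⁻¹, hγy, ?_, Yn_B⟩
      have := mul_mem hJ (inv_mem hX)
      convert this using 1
      refine Prod.ext ?_ rfl
      show th (εQ qy) = th (εQ qy) * th (εQ qx) * (th (εQ qx))⁻¹
      rw [mul_inv_cancel_right]
  | one => exact ⟨1, 1, by rw [map_one, map_one], by rw [map_one, map_one]; exact one_mem _, by simp⟩
  | mul a b _ _ iha ihb =>
    obtain ⟨o, n, h1, h2, h3⟩ := iha
    obtain ⟨o', n', h1', h2', h3'⟩ := ihb
    refine ⟨o * o', n * n', by rw [map_mul, map_mul, h1, h1'], ?_, ?_⟩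
    · have e : th (εQ (a * b)) = th (εQ a) * th (εQ b) := (congrArg th (map_mul εQ a b)).trans (map_mul th _ _)
      rw [e]; exact mul_mem h2 h2'
    · rw [Units.val_mul, Units.val_mul, mul_assoc, h3', ← mul_assoc, h3, mul_assoc]
  | inv a _ iha =>
    obtain ⟨o, n, h1, h2, h3⟩ := iha
    refine ⟨o⁻¹, n⁻¹, by rw [map_inv, map_inv, h1], ?_, ?_⟩
    · rw [map_inv, map_inv]; exact inv_mem h2
    · calc o⁻¹.val * Bm = o⁻¹.val * (Bm * n.val) * n⁻¹.val := by
            rw [mul_assoc, mul_assoc, Units.mul_inv, mul_one]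
        _ = _ := by rw [← h3, ← mul_assoc, Units.inv_mul, one_mul]

theorem hard_dir (γ : Q4 →* PGL3) (hγx : γ qx = pp X) (hγy : γ qy = pp Y) (q : Q4) (h : γ q = 1) : εQ q ∈ NN := by
  obtain ⟨o, n, h1, h2, h3⟩ := lifts γ hγx hγy q
  rw [h] at h1
  have hc : o ∈ Subgroup.center GL3 := (QuotientGroup.eq_one_iff _).mp h1.symm
  obtain ⟨f, hf⟩ := Matrix.GeneralLinearGroup.mem_center_iff_val_mem_range_scalar.mp hc
  obtain ⟨f', hf'⟩ := Matrix.GeneralLinearGroup.mem_center_iff_val_mem_range_scalar.mp (inv_mem hc)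
  have hff : f * f' = 1 := by
    have : o.val * o⁻¹.val = 1 := Units.mul_inv o
    rw [← hf, ← hf', ← map_mul] at this
    have := congrFun (congrFun this 0) 0
    simpa using this
  obtain ⟨k, rfl⟩ := unit_T hff
  have hn : n = scal k := by
    apply Units.ext
    apply Bm_cancel
    rw [← h3, ← hf, scal_val]
    exact Matrix.scalar_commute _ (fun r' => Commute.all _ _) _
  have hC : Ct (GrpG ⧸ NN) ∈ GG (th (εQ qx)) (th (εQ qy)) :=
    Subgroup.subset_closure (Or.inr (Or.inr rfl))
  have h4 := mul_mem h2 (zpow_mem hC (-k))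
  rw [Ct_zpow] at h4
  have h5 := main_inj hQH h4 (by
    show n * scal (-k) = 1
    rw [hn, ← scal_add, add_neg_cancel, scal_zero])
  have h6 : th (εQ q) * 1 = 1 := congrArg Prod.fst h5
  rw [mul_one] at h6
  exact (QuotientGroup.eq_one_iff _).mp h6

/-- **Theorem 1.1.** `ker γ = Q₄ ∩ ⟪[yxy,x]·t·x⁻¹·t⁻¹⟫_G`: for every `q ∈ Q₄`,
`γ(q) = 1` iff `ε(q)` lies in the normal closure in `G` of `[yxy,x]·t·x⁻¹·t⁻¹`. -/
theorem statement0 (γ : Q4 →* PGL3) (hγx : γ qx = pp X) (hγy : γ qy = pp Y) (q : Q4) :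
    γ q = 1 ↔
      εQ q ∈ Subgroup.normalClosure
        {br (εQ (qy * qx * qy)) (εQ qx) * tG * (εQ qx)⁻¹ * tG⁻¹} := by
  exact ⟨hard_dir γ hγx hγy q, easy_dir γ hγx hγy q⟩
end
end

section
/- The kernel of the homomorphism γ : Q₄ → PGL(3,R) is nontrivial; that is, there exists q ∈ Q₄ with q ≠ 1 and γ(q) = 1 (in fact q = [yxy,x]⁴ is such an element). -/
/-!
Common setup: the commutator convention `[a,b] = a⁻¹b⁻¹ab` of the paper, the sequence
`x₀ = x`, `x_{i+1} = [yxy, x_i]`, the Laurent polynomial ring `R = 𝔽₂[t,t⁻¹]`, and the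
images `X`, `Y` of `σ₁σ₂σ₃` and `σ₁σ₂σ₃σ₁` in `GL(3, R)` under the mod-2 reduced Burau
representation of the 4-strand braid group.
-/

open Matrix LaurentPolynomial

noncomputable section

set_option maxRecDepth 100000

set_option maxHeartbeats 4000000 in
lemma aux_B4 {K : Type*} [CommRing K] [CharP K 2] (u v : K) (h : u * v = 1)
    (A Ai X Y Xi Yi : Matrix (Fin 3) (Fin 3) K)
    (hX : X = u • !![0,0,1; 1,0,1; 0,1,1])
    (hY : Y = u • !![0,0,1; u,1,1; 0,1,1])
    (hXi : Xi = v • !![1,1,0; 1,0,1; 1,0,0])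
    (hYi : Yi = (v ^ 2) • !![0,1,1; u,0,u; u,0,0])
    (hA : A = Y * X * Y) (hAi : Ai = Yi * (Xi * Yi)) :
    (Ai * Xi * A * X) ^ 4 = 1 := by
  have h2 : (2 : K) = 0 := CharTwo.two_eq_zero
  have e1 : A * X = !![0, 0, u^5; u^4+u^5, u^5, u^4+u^5; u^4, 0, u^4+u^5] := by
    rw [hA, hX, hY]
    ext i j
    fin_cases i <;> fin_cases j <;> simp [Matrix.mul_apply, Fin.sum_univ_three] <;> grind
  have e2 : Ai * Xi = !![v^5, v^5, 0; 0, v^4, 0; 0, v^4, v^5] := by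
    rw [hAi, hXi, hYi]
    ext i j
    fin_cases i <;> fin_cases j <;> simp [Matrix.mul_apply, Fin.sum_univ_three] <;> grind
  have e3 : Ai * Xi * A * X = !![v+1, 1, v; 1+u, u, 1+u; v+1+u, u, v+u] := by
    rw [Matrix.mul_assoc _ A X, e1, e2]
    ext i j
    fin_cases i <;> fin_cases j <;> simp [Matrix.mul_apply, Fin.sum_univ_three] <;> grind
  have e4 : (Ai * Xi * A * X) ^ 2 = !![v+1+u, v+u, v+u; 0, 1, 0; v+u, v+u, v+1+u] := by
    rw [pow_two, e3]
    ext i j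
    fin_cases i <;> fin_cases j <;> simp [Matrix.mul_apply, Fin.sum_univ_three] <;> grind
  rw [show 4 = 2 * 2 from rfl, pow_mul, e4, pow_two, Matrix.one_fin_three]
  ext i j
  fin_cases i <;> fin_cases j <;> simp [Matrix.mul_apply, Fin.sum_univ_three] <;> grind

lemma GL_B4 : (br (Y * X * Y) X) ^ 4 = 1 := by
  apply Units.ext
  refine aux_B4 (T 1 : R2) (T (-1)) (by rw [← T_add]; simp)
    (Ymat * Xmat * Ymat) (Ymatinv * (Xmatinv * Ymatinv)) Xmat Ymat Xmatinv Ymatinv rfl rfl rfl ?_ rfl rfl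
  rw [pow_two, ← T_add]; rfl

def Mx : GL (Fin 3) (ZMod 5) :=
  ⟨!![0,0,3; 2,0,3; 0,2,3], (!![0,0,3; 2,0,3; 0,2,3]) ^ 3, by decide +kernel, by decide +kernel⟩

def My : GL (Fin 3) (ZMod 5) :=
  ⟨!![0,0,3; 1,2,3; 0,2,3], (!![0,0,3; 1,2,3; 0,2,3]) ^ 2, by decide +kernel, by decide +kernel⟩

lemma M_rels : ∀ r ∈ q4Rels, FreeGroup.lift ![Mx, My] r = 1 := by
  intro r hr
  rcases hr with rfl | rfl | rfl
  · simp only [map_pow, FreeGroup.lift_apply_of]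
    apply Units.ext
    change (!![0,0,3; 2,0,3; 0,2,3] : Matrix (Fin 3) (Fin 3) (ZMod 5)) ^ 4 = 1
    decide +kernel
  · simp only [map_pow, FreeGroup.lift_apply_of]
    apply Units.ext
    change (!![0,0,3; 1,2,3; 0,2,3] : Matrix (Fin 3) (Fin 3) (ZMod 5)) ^ 3 = 1
    decide +kernel
  · have : Mx ^ 2 * (My * Mx * My) = (My * Mx * My) * Mx ^ 2 := by
      apply Units.ext
      change (!![0,0,3; 2,0,3; 0,2,3] : Matrix (Fin 3) (Fin 3) (ZMod 5)) ^ 2 *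
        (!![0,0,3; 1,2,3; 0,2,3] * !![0,0,3; 2,0,3; 0,2,3] * !![0,0,3; 1,2,3; 0,2,3]) =
        (!![0,0,3; 1,2,3; 0,2,3] * !![0,0,3; 2,0,3; 0,2,3] * !![0,0,3; 1,2,3; 0,2,3]) *
          !![0,0,3; 2,0,3; 0,2,3] ^ 2
      decide +kernel
    simp only [br, map_mul, map_inv, map_pow, FreeGroup.lift_apply_of]
    change (Mx ^ 2)⁻¹ * (My * Mx * My)⁻¹ * Mx ^ 2 * (My * Mx * My) = 1
    rw [mul_assoc _ (Mx ^ 2), this]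
    group

lemma M_ne : (br (My * Mx * My) Mx) ^ 4 ≠ 1 := by
  intro h
  have h' := congrArg Units.val h
  change ((!![0,0,3; 1,2,3; 0,2,3] ^ 2 * (!![0,0,3; 2,0,3; 0,2,3] ^ 3 * !![0,0,3; 1,2,3; 0,2,3] ^ 2)) *
    !![0,0,3; 2,0,3; 0,2,3] ^ 3 *
    (!![0,0,3; 1,2,3; 0,2,3] * !![0,0,3; 2,0,3; 0,2,3] * !![0,0,3; 1,2,3; 0,2,3]) *
    !![0,0,3; 2,0,3; 0,2,3] : Matrix (Fin 3) (Fin 3) (ZMod 5)) ^ 4 = 1 at h'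
  revert h'
  decide +kernel

/-- **Corollary 1.2.** The kernel of `γ : Q₄ → PGL(3,R)` is nontrivial; in fact
`q = [yxy,x]⁴` is a nontrivial element of the kernel. -/
theorem statement1 (γ : Q4 →* PGL3) (hγx : γ qx = pp X) (hγy : γ qy = pp Y) :
    ∃ q : Q4, q ≠ 1 ∧ γ q = 1 ∧ q = (br (qy * qx * qy) qx) ^ 4 := by
  refine ⟨_, ?_, ?_, rfl⟩
  · intro h
    apply M_ne
    have h' := congrArg (PresentedGroup.toGroup M_rels) h
    simpa [br, qx, qy, PresentedGroup.toGroup.of] using h'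
  · have := congrArg pp GL_B4
    simp only [br, map_mul, map_inv, map_pow, map_one] at this
    simp only [br, map_mul, map_inv, map_pow, hγx, hγy]
    exact this
end
end
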